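/- arXiv:2507.02388 — 3 statements merged into one kernel-verified Lean document; each statement's English description precedes it below -/
import Mathlib

section
/- Let (X,g,J) be an almost-complex manifold, T a 3-form on X, and suppose ∇^B J = 0 where ∇^B_k V^i = ∇^LC_k V^i − (1/2) T_k{}^i{}_p V^p. Then T = i(∂ − ∂̄)ω + N, where ∂ω = (dω)^{2,1} and ∂̄ω = (dω)^{1,2} are the type components of dω with respect to J, and N is the Nijenhuis tensor regarded as a 3-tensor N_{pij}. -/
noncomputable section

/-!
# Statement 3

Let `(X,g,J)` be an almost-complex manifold, `T` a 3-form on `X`, and suppose `∇^B J = 0`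
where `∇^B_k V^i = ∇^LC_k V^i − (1/2) T_k{}^i{}_p V^p`.  Then `T = i(∂ − ∂̄)ω + N`, where
`∂ω = (dω)^{2,1}` and `∂̄ω = (dω)^{1,2}` are the type components of `dω` with respect to
`J`, and `N` is the Nijenhuis tensor regarded as a 3-tensor `N_{pij}`.

Pointwise tensor formulation; `nablaJ k p j` represents `∇^LC_k J^p{}_j`.  The type
decomposition of complexified forms is implemented with the projectors
`P^± = (1/2)(1 ∓ i J)` onto the `±i` eigenbundles of `J`, applied slotwise; a 3-form has
`(p,q)`-component obtained by applying `p` projectors `P^+` and `q` projectors `P^−` in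
all possible ways.
-/

open scoped BigOperators

variable {ι : Type*} [Fintype ι] [DecidableEq ι]

/-- `T` with its middle index raised: `T_a{}^p{}_b = g^{pq} T_{aqb}`. -/
def Tup (ginv : ι → ι → ℝ) (T : ι → ι → ι → ℝ) (a p b : ι) : ℝ := ∑ q, ginv p q * T a q b

/-- `∇^LC_k ω_{ij} = (∇^LC_k J^p{}_i) g_{pj}` (using `∇^LC g = 0`). -/
def nablaOm (g : ι → ι → ℝ) (nablaJ : ι → ι → ι → ℝ) (k i j : ι) : ℝ :=
  ∑ p, nablaJ k p i * g p j

/-- `(dω)_{kij} = ∇^LC_k ω_{ij} + ∇^LC_i ω_{jk} + ∇^LC_j ω_{ki}`. -/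
def dOm (g : ι → ι → ℝ) (nablaJ : ι → ι → ι → ℝ) (k i j : ι) : ℝ :=
  nablaOm g nablaJ k i j + nablaOm g nablaJ i j k + nablaOm g nablaJ j k i

/-- The complexification of `dω`. -/
def dOmC (g : ι → ι → ℝ) (nablaJ : ι → ι → ι → ℝ) (k i j : ι) : ℂ :=
  (dOm g nablaJ k i j : ℝ)

/-- The Nijenhuis tensor
`N^p{}_{ij} = (1/4)(J^k{}_i ∇^LC_k J^p{}_j + J^p{}_k ∇^LC_j J^k{}_i − (i ↔ j))`. -/
def Nup (J : ι → ι → ℝ) (nablaJ : ι → ι → ι → ℝ) (p i j : ι) : ℝ :=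
  (1/4) * ((∑ k, J k i * nablaJ k p j) + (∑ k, J p k * nablaJ j k i)
    - (∑ k, J k j * nablaJ k p i) - (∑ k, J p k * nablaJ i k j))

/-- `N_{pij} = g_{pk} N^k{}_{ij}`. -/
def Nlow (g J : ι → ι → ℝ) (nablaJ : ι → ι → ι → ℝ) (p i j : ι) : ℝ :=
  ∑ k, g p k * Nup J nablaJ k i j

/-- The projector `P^+ = (1/2)(1 − iJ)` (for `s = true`) resp. `P^- = (1/2)(1 + iJ)`
(for `s = false`) acting on a lower index: `(P^± η)_i = (1/2)(η_i ∓ i J^a{}_i η_a)`. -/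
def prC (J : ι → ι → ℝ) (s : Bool) (a i : ι) : ℂ :=
  (2⁻¹ : ℂ) * ((if a = i then 1 else 0)
    - (if s then (1:ℂ) else (-1:ℂ)) * Complex.I * (J a i : ℝ))

/-- Slotwise projection of a complexified 3-tensor. -/
def proj3 (J : ι → ι → ℝ) (s1 s2 s3 : Bool) (A : ι → ι → ι → ℂ) (i j k : ι) : ℂ :=
  ∑ a, ∑ b, ∑ c, prC J s1 a i * prC J s2 b j * prC J s3 c k * A a b c

/-- The `(2,1)`-component of a complexified 3-form. -/
def comp21 (J : ι → ι → ℝ) (A : ι → ι → ι → ℂ) (i j k : ι) : ℂ :=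
  proj3 J true true false A i j k + proj3 J true false true A i j k
    + proj3 J false true true A i j k

/-- The `(1,2)`-component of a complexified 3-form. -/
def comp12 (J : ι → ι → ℝ) (A : ι → ι → ι → ℂ) (i j k : ι) : ℂ :=
  proj3 J true false false A i j k + proj3 J false true false A i j k
    + proj3 J false false true A i j k

def sA (J : ι → ι → ℝ) (A : ι → ι → ι → ℝ) (i j k : ι) : ℝ := ∑ a, J a i * A a j k
def sB (J : ι → ι → ℝ) (A : ι → ι → ι → ℝ) (i j k : ι) : ℝ := ∑ a, J a j * A i a k
def sC (J : ι → ι → ℝ) (A : ι → ι → ι → ℝ) (i j k : ι) : ℝ := ∑ a, J a k * A i j a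

theorem prC_sum (J : ι → ι → ℝ) (s : Bool) (i : ι) (f : ι → ℂ) :
    ∑ a, prC J s a i * f a
      = (2⁻¹ : ℂ) * (f i - (if s then (1:ℂ) else (-1:ℂ)) * Complex.I * ∑ a, (J a i : ℂ) * f a) := by
  have h : ∀ a, prC J s a i * f a = (2⁻¹ : ℂ) * ((if a = i then f a else 0)
      - (if s then (1:ℂ) else (-1:ℂ)) * Complex.I * ((J a i : ℂ) * f a)) := by
    intro a
    unfold prC
    by_cases h : a = i
    · simp only [h, if_true]; ring
    · simp only [h, if_false]; ring
  simp only [h, ← Finset.mul_sum, Finset.sum_sub_distrib, Finset.sum_ite_eq', Finset.mem_univ,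
    if_true]

def eI (s : Bool) : ℂ := (if s then (1:ℂ) else (-1:ℂ)) * Complex.I

theorem proj3_eq (J : ι → ι → ℝ) (s1 s2 s3 : Bool) (A : ι → ι → ι → ℝ) (i j k : ι) :
    proj3 J s1 s2 s3 (fun a b c => (A a b c : ℂ)) i j k =
      (8⁻¹ : ℂ) * (A i j k - eI s1 * sA J A i j k - eI s2 * sB J A i j k - eI s3 * sC J A i j k
        + eI s1 * eI s2 * sA J (sB J A) i j k + eI s1 * eI s3 * sA J (sC J A) i j k
        + eI s2 * eI s3 * sB J (sC J A) i j k
        - eI s1 * eI s2 * eI s3 * sA J (sB J (sC J A)) i j k) := by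
  have h : proj3 J s1 s2 s3 (fun a b c => (A a b c : ℂ)) i j k =
      ∑ a, prC J s1 a i * ∑ b, prC J s2 b j * ∑ c, prC J s3 c k * (A a b c : ℂ) := by
    unfold proj3
    simp only [Finset.mul_sum, mul_assoc]
  rw [h]
  simp only [prC_sum]
  have e1 : ∀ s : Bool, (if s then (1:ℂ) else (-1:ℂ)) * Complex.I = eI s := fun s => rfl
  simp only [e1]
  have r1 : ∀ (m : ι) (x : ι → ℂ), ∑ a, (J a m : ℂ) * ((2⁻¹ : ℂ) * x a)
      = (2⁻¹ : ℂ) * ∑ a, (J a m : ℂ) * x a := by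
    intro m x; rw [Finset.mul_sum]; exact Finset.sum_congr rfl fun _ _ => by ring
  have r2 : ∀ (m : ι) (s : Bool) (x : ι → ℂ), ∑ a, (J a m : ℂ) * (eI s * x a)
      = eI s * ∑ a, (J a m : ℂ) * x a := by
    intro m s x; rw [Finset.mul_sum]; exact Finset.sum_congr rfl fun _ _ => by ring
  have r3 : ∀ (m : ι) (x y : ι → ℂ), ∑ a, (J a m : ℂ) * (x a - y a)
      = ∑ a, (J a m : ℂ) * x a - ∑ a, (J a m : ℂ) * y a := by
    intro m x y; simp only [mul_sub, Finset.sum_sub_distrib]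
  simp only [r1, r2, r3]
  simp only [sA, sB, sC, Complex.ofReal_sum, Complex.ofReal_mul]
  ring

section
variable {J : ι → ι → ℝ}

theorem JJ (hJ2 : ∀ i j, ∑ p, J i p * J p j = (if i = j then (-1:ℝ) else 0))
    (f : ι → ℝ) (i : ι) : ∑ a, J a i * ∑ b, J b a * f b = - f i := by
  simp only [Finset.mul_sum]
  rw [Finset.sum_comm]
  have : ∀ b, ∑ a, J a i * (J b a * f b) = (if b = i then -f b else 0) := by
    intro b
    have : ∀ a, J a i * (J b a * f b) = (J b a * J a i) * f b := fun a => by ring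
    simp only [this, ← Finset.sum_mul, hJ2]
    split_ifs <;> simp
  simp [this]

theorem comm2 (f : ι → ι → ℝ) (i j : ι) :
    ∑ a, J a i * ∑ b, J b j * f a b = ∑ b, J b j * ∑ a, J a i * f a b := by
  simp only [Finset.mul_sum]
  rw [Finset.sum_comm]
  refine Finset.sum_congr rfl fun _ _ => Finset.sum_congr rfl fun _ _ => by ring
end

theorem skew {g J : ι → ι → ℝ}
    (hJ2 : ∀ i j, ∑ p, J i p * J p j = (if i = j then (-1:ℝ) else 0))
    (hcompat : ∀ i j, ∑ k, ∑ l, J k i * J l j * g k l = g i j) (p k : ι) :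
    ∑ q, J q k * g p q = - ∑ l, J l p * g l k := by
  have h : ∀ i j, g i j = ∑ l, J l j * ∑ k, J k i * g k l := by
    intro i j
    rw [← hcompat, Finset.sum_comm]
    simp only [Finset.mul_sum]
    refine Finset.sum_congr rfl fun _ _ => Finset.sum_congr rfl fun _ _ => by ring
  calc ∑ q, J q k * g p q = ∑ q, J q k * ∑ l, J l q * ∑ m, J m p * g m l := by
        refine Finset.sum_congr rfl fun q _ => by rw [← h]
    _ = _ := JJ hJ2 (fun l => ∑ m, J m p * g m l) k

theorem lower {g ginv : ι → ι → ℝ} {T : ι → ι → ι → ℝ}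
    (hgsymm : ∀ i j, g i j = g j i)
    (hginv : ∀ i j, ∑ k, ginv i k * g k j = (if i = j then (1:ℝ) else 0)) (k j r : ι) :
    ∑ p, g p j * Tup ginv T k p r = T k j r := by
  have h1 : (Matrix.of ginv) * (Matrix.of g) = 1 := by
    ext i j
    simp [Matrix.mul_apply, hginv, Matrix.one_apply]
  have h2 := mul_eq_one_comm.mp h1
  have h3 : ∀ q, ∑ p, g p j * ginv p q = if j = q then 1 else 0 := by
    intro q
    have := congrFun (congrFun h2 j) q
    simp only [Matrix.mul_apply, Matrix.of_apply, Matrix.one_apply] at this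
    rw [← this]
    exact Finset.sum_congr rfl fun p _ => by rw [hgsymm]
  unfold Tup
  simp only [Finset.mul_sum]
  rw [Finset.sum_comm]
  simp only [← mul_assoc, ← Finset.sum_mul, h3]
  simp

theorem nablaOm_eq {g ginv J : ι → ι → ℝ} {T nablaJ : ι → ι → ι → ℝ}
    (hgsymm : ∀ i j, g i j = g j i)
    (hginv : ∀ i j, ∑ k, ginv i k * g k j = (if i = j then (1:ℝ) else 0))
    (hJ2 : ∀ i j, ∑ p, J i p * J p j = (if i = j then (-1:ℝ) else 0))
    (hcompat : ∀ i j, ∑ k, ∑ l, J k i * J l j * g k l = g i j)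
    (hBJ : ∀ k p j,
      nablaJ k p j - (1/2) * (∑ r, Tup ginv T k p r * J r j)
        + (1/2) * (∑ r, Tup ginv T k r j * J p r) = 0) (k i j : ι) :
    nablaOm g nablaJ k i j
      = (1/2) * ∑ r, J r i * T k j r + (1/2) * ∑ r, J r j * T k r i := by
  have h : ∀ p, nablaJ k p i * g p j = (1/2) * (∑ r, J r i * (g p j * Tup ginv T k p r))
      - (1/2) * ∑ r, (J p r * g p j) * Tup ginv T k r i := by
    intro p
    have h1 : nablaJ k p i = (1/2) * (∑ r, Tup ginv T k p r * J r i)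
        - (1/2) * (∑ r, Tup ginv T k r i * J p r) := by linarith [hBJ k p i]
    rw [h1, sub_mul, mul_assoc, mul_assoc, Finset.sum_mul, Finset.sum_mul]
    congr 2 <;> exact Finset.sum_congr rfl fun _ _ => by ring
  unfold nablaOm
  simp only [h, Finset.sum_sub_distrib, ← Finset.mul_sum]
  rw [Finset.sum_comm, Finset.sum_comm (f := fun p r => (J p r * g p j) * Tup ginv T k r i)]
  have h2 : ∀ r, ∑ p, (J p r * g p j) = - ∑ l, J l j * g l r := by
    intro r
    rw [← skew hJ2 hcompat]
    exact Finset.sum_congr rfl fun p _ => by rw [hgsymm]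
  simp only [← Finset.mul_sum, ← Finset.sum_mul, lower hgsymm hginv, h2]
  have h3 : ∑ r, (- ∑ l, J l j * g l r) * Tup ginv T k r i = - ∑ r, J r j * T k r i := by
    simp only [neg_mul, Finset.sum_neg_distrib, Finset.sum_mul]
    rw [Finset.sum_comm]
    simp only [mul_assoc, ← Finset.mul_sum]
    congr 1
    refine Finset.sum_congr rfl fun l _ => ?_
    congr 1
    rw [← lower (T := T) hgsymm hginv]
    exact Finset.sum_congr rfl fun p _ => by rw [hgsymm]
  rw [h3]; ring

theorem Nlow_eq {g J : ι → ι → ℝ} {nablaJ : ι → ι → ι → ℝ}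
    (hgsymm : ∀ i j, g i j = g j i)
    (hJ2 : ∀ i j, ∑ p, J i p * J p j = (if i = j then (-1:ℝ) else 0))
    (hcompat : ∀ i j, ∑ k, ∑ l, J k i * J l j * g k l = g i j) (p i j : ι) :
    Nlow g J nablaJ p i j = (1/4) * ((∑ k, J k i * nablaOm g nablaJ k j p)
      - (∑ l, J l p * nablaOm g nablaJ j i l)
      - (∑ k, J k j * nablaOm g nablaJ k i p) + (∑ l, J l p * nablaOm g nablaJ i j l)) := by
  have h1 : ∀ i j, ∑ q, g p q * ∑ k, J k i * nablaJ k q j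
      = ∑ k, J k i * nablaOm g nablaJ k j p := by
    intro i j
    unfold nablaOm
    simp only [Finset.mul_sum]
    rw [Finset.sum_comm]
    refine Finset.sum_congr rfl fun _ _ => Finset.sum_congr rfl fun q _ => ?_
    rw [hgsymm p q]; ring
  have h2 : ∀ i j, ∑ q, g p q * ∑ k, J q k * nablaJ j k i
      = - ∑ l, J l p * nablaOm g nablaJ j i l := by
    intro i j
    unfold nablaOm
    have : ∀ k, ∑ q, g p q * (J q k * nablaJ j k i)
        = - ∑ l, J l p * (nablaJ j k i * g k l) := by
      intro k
      have e : ∀ q, g p q * (J q k * nablaJ j k i) = (J q k * g p q) * nablaJ j k i :=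
        fun q => by ring
      simp only [e, ← Finset.sum_mul, skew hJ2 hcompat]
      rw [neg_mul, Finset.sum_mul]
      congr 1
      refine Finset.sum_congr rfl fun l _ => ?_
      rw [hgsymm k l]; ring
    simp only [Finset.mul_sum]
    rw [Finset.sum_comm, Finset.sum_comm (f := fun l k => J l p * (nablaJ j k i * g k l))]
    simp only [this, Finset.sum_neg_distrib]
  unfold Nlow Nup
  simp only [mul_sub, mul_add, Finset.sum_add_distrib, Finset.sum_sub_distrib,
    mul_left_comm _ (1/4 : ℝ), ← Finset.mul_sum, h1, h2]
  ring

theorem stmt3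
    (g ginv J : ι → ι → ℝ) (T : ι → ι → ι → ℝ) (nablaJ : ι → ι → ι → ℝ)
    -- `g` is a Riemannian metric: symmetric, with inverse `ginv`
    (hgsymm : ∀ i j, g i j = g j i)
    (hginv : ∀ i j, ∑ k, ginv i k * g k j = (if i = j then (1:ℝ) else 0))
    -- `J` is an almost complex structure: `J^i{}_p J^p{}_j = −δ^i{}_j`
    (hJ2 : ∀ i j, ∑ p, J i p * J p j = (if i = j then (-1:ℝ) else 0))
    -- compatibility `g(JV, JW) = g(V, W)`
    (hcompat : ∀ i j, ∑ k, ∑ l, J k i * J l j * g k l = g i j)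
    -- `T` is a 3-form (totally antisymmetric)
    (hT1 : ∀ i j k, T i j k = -T j i k)
    (hT2 : ∀ i j k, T i j k = -T i k j)
    -- `∇^B J = 0`, i.e.
    -- `∇^LC_k J^p{}_j − (1/2) T_k{}^p{}_r J^r{}_j + (1/2) T_k{}^r{}_j J^p{}_r = 0`
    (hBJ : ∀ k p j,
      nablaJ k p j - (1/2) * (∑ r, Tup ginv T k p r * J r j)
        + (1/2) * (∑ r, Tup ginv T k r j * J p r) = 0) :
    -- conclusion: `T = i(∂ − ∂̄)ω + N` as complexified 3-tensors, where
    -- `∂ω = (dω)^{2,1}` and `∂̄ω = (dω)^{1,2}`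
    ∀ i j k,
      (T i j k : ℂ)
        = Complex.I * (comp21 J (dOmC g nablaJ) i j k - comp12 J (dOmC g nablaJ) i j k)
          + (Nlow g J nablaJ i j k : ℝ) := by
  intro i j k
  have hA : ∀ f : ι → ι → ι → ℝ, sA J (sA J f) = fun a b c => - f a b c := by
    intro f; funext a b c; exact JJ hJ2 (fun x => f x b c) a
  have hB : ∀ f : ι → ι → ι → ℝ, sB J (sB J f) = fun a b c => - f a b c := by
    intro f; funext a b c; exact JJ hJ2 (fun x => f a x c) b
  have hC : ∀ f : ι → ι → ι → ℝ, sC J (sC J f) = fun a b c => - f a b c := by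
    intro f; funext a b c; exact JJ hJ2 (fun x => f a b x) c
  have hBA : ∀ f : ι → ι → ι → ℝ, sB J (sA J f) = sA J (sB J f) := by
    intro f; funext a b c; exact comm2 (fun y x => f x y c) b a
  have hCA : ∀ f : ι → ι → ι → ℝ, sC J (sA J f) = sA J (sC J f) := by
    intro f; funext a b c; exact comm2 (fun y x => f x b y) c a
  have hCB : ∀ f : ι → ι → ι → ℝ, sC J (sB J f) = sB J (sC J f) := by
    intro f; funext a b c; exact comm2 (fun y x => f a x y) c b
  have T3 : ∀ a b c, T a b c = T b c a := fun a b c => by rw [hT1 a b c, hT2 b a c, neg_neg]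
  have hO : ∀ a b c, nablaOm g nablaJ a b c = -(1/2) * (sB J T a b c + sC J T a b c) := by
    intro a b c
    rw [nablaOm_eq hgsymm hginv hJ2 hcompat hBJ]
    have e1 : ∑ r, J r b * T a c r = - sB J T a b c := by
      unfold sB; rw [← Finset.sum_neg_distrib]
      exact Finset.sum_congr rfl fun r _ => by rw [hT2 a c r]; ring
    have e2 : ∑ r, J r c * T a r b = - sC J T a b c := by
      unfold sC; rw [← Finset.sum_neg_distrib]
      exact Finset.sum_congr rfl fun r _ => by rw [hT2 a r b]; ring
    rw [e1, e2]; ring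
  have cA : ∀ a b c, sA J T a b c = sC J T b c a := fun a b c =>
    Finset.sum_congr rfl fun r _ => by rw [T3 r b c]
  have cB : ∀ a b c, sB J T a b c = sA J T b c a := fun a b c =>
    Finset.sum_congr rfl fun r _ => by rw [T3 a r c]
  have cC : ∀ a b c, sC J T a b c = sB J T b c a := fun a b c =>
    Finset.sum_congr rfl fun r _ => by rw [T3 a b r]
  have hd : dOm g nablaJ = fun a b c => (-1) * (sA J T a b c + sB J T a b c + sC J T a b c) := by
    funext a b c
    unfold dOm
    rw [hO, hO, hO, ← cA a b c, ← cC a b c, cB c a b, cC c a b]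
    ring
  have lA : ∀ f h l : ι → ι → ι → ℝ, sA J (fun a b c => (-1) * (f a b c + h a b c + l a b c))
      = fun a b c => (-1) * (sA J f a b c + sA J h a b c + sA J l a b c) := by
    intro f h l; funext a b c
    simp only [sA, mul_add, Finset.sum_add_distrib, mul_left_comm _ (-1 : ℝ), ← Finset.mul_sum]
  have lB : ∀ f h l : ι → ι → ι → ℝ, sB J (fun a b c => (-1) * (f a b c + h a b c + l a b c))
      = fun a b c => (-1) * (sB J f a b c + sB J h a b c + sB J l a b c) := by
    intro f h l; funext a b c
    simp only [sB, mul_add, Finset.sum_add_distrib, mul_left_comm _ (-1 : ℝ), ← Finset.mul_sum]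
  have lC : ∀ f h l : ι → ι → ι → ℝ, sC J (fun a b c => (-1) * (f a b c + h a b c + l a b c))
      = fun a b c => (-1) * (sC J f a b c + sC J h a b c + sC J l a b c) := by
    intro f h l; funext a b c
    simp only [sC, mul_add, Finset.sum_add_distrib, mul_left_comm _ (-1 : ℝ), ← Finset.mul_sum]
  have nA : ∀ f : ι → ι → ι → ℝ, sA J (fun a b c => - f a b c) = fun a b c => - sA J f a b c := by
    intro f; funext a b c; simp [sA]
  have nB : ∀ f : ι → ι → ι → ℝ, sB J (fun a b c => - f a b c) = fun a b c => - sB J f a b c := by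
    intro f; funext a b c; simp [sB]
  -- Nijenhuis tensor
  have hN : Nlow g J nablaJ i j k = (1/4) * (T i j k - sB J (sC J T) i j k
      - sA J (sB J T) i j k - sA J (sC J T) i j k) := by
    rw [Nlow_eq hgsymm hJ2 hcompat]
    have a1 : ∀ a, nablaOm g nablaJ a k i = -(1/2) * (sC J T i a k + sA J T i a k) := by
      intro a; rw [hO, ← cC i a k, cC a k i, cB k i a]
    have a2 : ∀ a, nablaOm g nablaJ k j a = (1/2) * (sA J T a j k + sB J T a j k) := by
      intro a
      have e1 : sB J T k j a = - sB J T a j k := by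
        unfold sB; rw [← Finset.sum_neg_distrib]
        exact Finset.sum_congr rfl fun r _ => by rw [hT1 k r a, hT2 r k a, hT1 r a k]; ring
      have e2 : sC J T k j a = - sA J T a j k := by
        unfold sC sA; rw [← Finset.sum_neg_distrib]
        exact Finset.sum_congr rfl fun r _ => by rw [hT1 k j r, hT2 j k r, hT1 j r k]; ring
      rw [hO, e1, e2]; ring
    have a3 : ∀ a, nablaOm g nablaJ a j i = (1/2) * (sB J T i j a + sA J T i j a) := by
      intro a
      have e1 : sB J T a j i = - sB J T i j a := by
        unfold sB; rw [← Finset.sum_neg_distrib]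
        exact Finset.sum_congr rfl fun r _ => by rw [hT1 a r i, hT2 r a i, hT1 r i a]; ring
      have e2 : sC J T a j i = - sA J T i j a := by
        unfold sC sA; rw [← Finset.sum_neg_distrib]
        exact Finset.sum_congr rfl fun r _ => by rw [hT1 a j r, hT2 j a r, hT1 j r a]; ring
      rw [hO, e1, e2]; ring
    have a4 : ∀ a, nablaOm g nablaJ j k a = -(1/2) * (sC J T a j k + sA J T a j k) := by
      intro a; rw [hO, ← cC a j k, cC j k a, cB k a j]
    simp only [a1, a2, a3, a4, mul_add, Finset.sum_add_distrib, mul_left_comm _ (1/2 : ℝ),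
      mul_left_comm _ (-(1/2) : ℝ), ← Finset.mul_sum]
    have b1 : ∀ f : ι → ι → ι → ℝ, ∑ x, J x i * f x j k = sA J f i j k := fun f => rfl
    have b2 : ∀ f : ι → ι → ι → ℝ, ∑ x, J x j * f i x k = sB J f i j k := fun f => rfl
    have b3 : ∀ f : ι → ι → ι → ℝ, ∑ x, J x k * f i j x = sC J f i j k := fun f => rfl
    simp only [b1, b2, b3, hA, hBA, hCA, hCB]
    ring
  have hdC : dOmC g nablaJ = fun a b c => ((dOm g nablaJ a b c : ℝ) : ℂ) := rfl
  rw [hN, hdC]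
  unfold comp21 comp12
  simp only [proj3_eq]
  rw [hd]
  simp only [lA, lB, lC, hA, hB, hC, hBA, hCA, hCB, nA, nB]
  push_cast
  have hI : Complex.I ^ 2 = -1 := Complex.I_sq
  have hI4 : Complex.I ^ 4 = 1 := Complex.I_pow_four
  simp only [eI, if_true, Bool.false_eq_true, if_false]
  ring_nf
  simp only [hI, hI4]
  ring
end
end

section
/- Let X be a complex threefold with hermitian metric ω and holomorphic volume form Ω, and suppose the conformally balanced condition d(‖Ω‖_ω ω²) = 0 holds. Then the Chern curvature satisfies R^{CH}{}_μ{}^μ{}_{β̄α} = −(i∂∂̄ω)_μ{}^μ{}_{β̄α} + T_{αμν̄} T^{μν̄}{}_{β̄}, where T = i(∂−∂̄)ω; this measures the deviation of the Chern connection of a conformally balanced metric from being an instanton. -/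
noncomputable section

/-!
# Statement 9

Let `X` be a complex threefold with hermitian metric `ω` and holomorphic volume form `Ω`,
and suppose the conformally balanced condition `d(‖Ω‖_ω ω²) = 0` holds.  Then the Chern
curvature satisfies
`R^{CH}{}_μ{}^μ{}_{β̄α} = −(i∂∂̄ω)_μ{}^μ{}_{β̄α} + T_{αμν̄} T^{μν̄}{}_{β̄}`,
where `T = i(∂−∂̄)ω`; this measures the deviation of the Chern connection of a conformally
balanced metric from being an instanton.

Formalised on the local model `ℂ³`, where `Ω = f dz¹ ∧ dz² ∧ dz³` with `f` a nonvanishing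
holomorphic function and `‖Ω‖_ω² = |f|² (det g_{μν̄})⁻¹`.
-/
open scoped BigOperators

/-! ## The local model

`Pt = ℂ³` with its standard holomorphic coordinates is the local model of a complex
threefold.  Tensors are given by their components in the complexified coordinate frame:
the index type is `Ix = Fin 3 ⊕ Fin 3`, where `Sum.inl μ` is the holomorphic index `μ`
and `Sum.inr μ` is the antiholomorphic index `μ̄`.  A hermitian metric
`ω = i g_{μν̄} dz^μ ∧ dz̄^ν` is encoded by its components `g μ ν = g_{μν̄}` together with
the components `ginv α β = g^{αβ̄}` of the inverse metric.  Components of a `p`-form `Q`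
follow the normalization `Q = (1/p!) Q_{m₁⋯m_p} dx^{m₁} ∧ ⋯ ∧ dx^{m_p}`.
-/

/-- The local model of a complex threefold: `ℂ³`. -/
abbrev Pt : Type := EuclideanSpace ℂ (Fin 3)

/-- The holomorphic Wirtinger derivative `∂/∂z^μ`. -/
def Dh (μ : Fin 3) (f : Pt → ℂ) : Pt → ℂ := fun z =>
  (2⁻¹ : ℂ) * (fderiv ℝ f z (EuclideanSpace.single μ 1)
    - Complex.I * fderiv ℝ f z (EuclideanSpace.single μ Complex.I))

/-- The antiholomorphic Wirtinger derivative `∂/∂z̄^μ`. -/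
def Da (μ : Fin 3) (f : Pt → ℂ) : Pt → ℂ := fun z =>
  (2⁻¹ : ℂ) * (fderiv ℝ f z (EuclideanSpace.single μ 1)
    + Complex.I * fderiv ℝ f z (EuclideanSpace.single μ Complex.I))

/-- Complexified coordinate index: `inl μ ↦ z^μ`, `inr μ ↦ z̄^μ`. -/
abbrev Ix : Type := Fin 3 ⊕ Fin 3

/-- The partial derivative in the direction of a complexified index. -/
def DF : Ix → (Pt → ℂ) → (Pt → ℂ)
  | Sum.inl μ => Dh μ
  | Sum.inr μ => Da μ

/-- Number of holomorphic indices (`1` for `inl`, `0` for `inr`). -/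
def nHol : Ix → ℕ
  | Sum.inl _ => 1
  | Sum.inr _ => 0

/-- Full components of the hermitian metric: `gF_{μν̄} = g_{μν̄}`, `gF_{ν̄μ} = g_{μν̄}`,
and the pure components vanish. -/
def gF (g : Fin 3 → Fin 3 → Pt → ℂ) : Ix → Ix → Pt → ℂ
  | Sum.inl μ, Sum.inr ν => g μ ν
  | Sum.inr ν, Sum.inl μ => g μ ν
  | _, _ => 0

/-- Full components of the inverse metric. -/
def ginvF (ginv : Fin 3 → Fin 3 → Pt → ℂ) : Ix → Ix → Pt → ℂ
  | Sum.inl α, Sum.inr β => ginv α β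
  | Sum.inr β, Sum.inl α => ginv α β
  | _, _ => 0

/-- Full components of the hermitian form `ω = i g_{μν̄} dz^μ ∧ dz̄^ν`. -/
def omF (g : Fin 3 → Fin 3 → Pt → ℂ) : Ix → Ix → Pt → ℂ
  | Sum.inl μ, Sum.inr ν => fun z => Complex.I * g μ ν z
  | Sum.inr ν, Sum.inl μ => fun z => -(Complex.I * g μ ν z)
  | _, _ => 0

/-- Exterior derivative of a 2-form, in components. -/
def dTwo (η : Ix → Ix → Pt → ℂ) (a b c : Ix) : Pt → ℂ := fun z =>
  DF a (η b c) z - DF b (η a c) z + DF c (η a b) z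

/-- Exterior derivative of a 3-form, in components. -/
def dThree (η : Ix → Ix → Ix → Pt → ℂ) (a b c d : Ix) : Pt → ℂ := fun z =>
  DF a (η b c d) z - DF b (η a c d) z + DF c (η a b d) z - DF d (η a b c) z

/-- Exterior derivative of a 4-form, in components. -/
def dFour (η : Ix → Ix → Ix → Ix → Pt → ℂ) (a b c d e : Ix) : Pt → ℂ := fun z =>
  DF a (η b c d e) z - DF b (η a c d e) z + DF c (η a b d e) z
    - DF d (η a b c e) z + DF e (η a b c d) z

/-- The torsion 3-form `T = i(∂ − ∂̄)ω`:  on a complex manifold, the `(2,1)`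
(resp. `(1,2)`) part of `dω` is obtained by restricting to index patterns with exactly
two (resp. one) holomorphic indices.  In particular
`T_{μνρ̄} = −∂_μ g_{νρ̄} + ∂_ν g_{μρ̄}`. -/
def TorF (g : Fin 3 → Fin 3 → Pt → ℂ) (a b c : Ix) : Pt → ℂ := fun z =>
  Complex.I * ((if nHol a + nHol b + nHol c = 2 then (1:ℂ) else 0)
    - (if nHol a + nHol b + nHol c = 1 then (1:ℂ) else 0)) * dTwo (omF g) a b c z

/-- The `(1,2)` part `∂̄ω` of `dω`. -/
def pbarOm (g : Fin 3 → Fin 3 → Pt → ℂ) (a b c : Ix) : Pt → ℂ := fun z =>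
  if nHol a + nHol b + nHol c = 1 then dTwo (omF g) a b c z else 0

/-- The `(2,2)`-form `i ∂∂̄ω`, obtained as `i` times the `(2,2)` part of `d(∂̄ω)`. -/
def iddbarOm (g : Fin 3 → Fin 3 → Pt → ℂ) (a b c d : Ix) : Pt → ℂ := fun z =>
  Complex.I * (if nHol a + nHol b + nHol c + nHol d = 2
    then dThree (pbarOm g) a b c d z else 0)

/-- The trace `T_μ{}^μ{}_m = g^{μν̄} T_{μν̄m}` of the torsion. -/
def TrT (g ginv : Fin 3 → Fin 3 → Pt → ℂ) (m : Ix) : Pt → ℂ := fun z =>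
  ∑ μ, ∑ ν, ginv μ ν z * TorF g (Sum.inl μ) (Sum.inr ν) m z

/-- Chern connection symbols `Γ^{CH}{}_μ{}^ν{}_ρ = g^{νσ̄} ∂_μ g_{ρσ̄}`. -/
def GamCH (g ginv : Fin 3 → Fin 3 → Pt → ℂ) (μ ν ρ : Fin 3) : Pt → ℂ := fun z =>
  ∑ σ, ginv ν σ z * Dh μ (g ρ σ) z

/-- Chern curvature `R^{CH}{}_{μν̄}{}^α{}_β = −∂_ν̄ (g^{ασ̄} ∂_μ g_{βσ̄})`. -/
def RCH (g ginv : Fin 3 → Fin 3 → Pt → ℂ) (μ ν α β : Fin 3) : Pt → ℂ := fun z =>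
  -(Da ν (GamCH g ginv μ α β) z)

/-- Full Chern connection symbols: the only nonvanishing components are
`Γ_μ{}^ν{}_ρ` and their conjugates. -/
def GamCHF (g ginv : Fin 3 → Fin 3 → Pt → ℂ) : Ix → Ix → Ix → Pt → ℂ
  | Sum.inl μ, Sum.inl ν, Sum.inl ρ => GamCH g ginv μ ν ρ
  | Sum.inr μ, Sum.inr ν, Sum.inr ρ => fun z => (starRingEnd ℂ) (GamCH g ginv μ ν ρ z)
  | _, _, _ => 0

/-- Chern covariant derivative of a 1-form, `∇^{CH}_a η_m = ∂_a η_m − Γ_a{}^b{}_m η_b`. -/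
def covCH1 (g ginv : Fin 3 → Fin 3 → Pt → ℂ) (a : Ix) (η : Ix → Pt → ℂ) (m : Ix) :
    Pt → ℂ := fun z =>
  DF a (η m) z - ∑ b, GamCHF g ginv a b m z * η b z

/-- Components of the wedge product of two 2-forms. -/
def wedge22 (A B : Ix → Ix → Pt → ℂ) (a b c d : Ix) : Pt → ℂ := fun z =>
  A a b z * B c d z - A a c z * B b d z + A a d z * B b c z
    + A c d z * B a b z - A b d z * B a c z + A b c z * B a d z

/-- `det (g_{μν̄})`. -/
def detg (g : Fin 3 → Fin 3 → Pt → ℂ) : Pt → ℂ := fun z =>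
  Matrix.det (Matrix.of fun μ ν => g μ ν z)

/-- The norm `‖Ω‖_ω` of the holomorphic volume form `Ω = f dz¹²³`, where locally
`‖Ω‖_ω² = |f|² (det g_{μν̄})⁻¹`. -/
def nrmOm (g : Fin 3 → Fin 3 → Pt → ℂ) (f : Pt → ℂ) : Pt → ℝ := fun z =>
  Real.sqrt (Complex.normSq (f z) / (detg g z).re)

/-- Generic Wirtinger-type derivative, covering both `Dh` and `Da`. -/
def Wd (c : ℂ) (μ : Fin 3) (f : Pt → ℂ) : Pt → ℂ := fun z =>
  (2⁻¹ : ℂ) * (fderiv ℝ f z (EuclideanSpace.single μ 1)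
    + c * fderiv ℝ f z (EuclideanSpace.single μ Complex.I))

lemma Dh_eq (μ : Fin 3) : Dh μ = Wd (-Complex.I) μ := by
  funext f z; simp only [Dh, Wd]; ring

lemma Da_eq (μ : Fin 3) : Da μ = Wd Complex.I μ := rfl

lemma Wd_const (c : ℂ) (μ : Fin 3) (k : ℂ) (z : Pt) : Wd c μ (fun _ => k) z = 0 := by
  simp [Wd]

lemma Wd_add (c : ℂ) (μ : Fin 3) {f h : Pt → ℂ} {z : Pt} (hf : DifferentiableAt ℝ f z)
    (hh : DifferentiableAt ℝ h z) : Wd c μ (fun w => f w + h w) z = Wd c μ f z + Wd c μ h z := by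
  simp only [Wd]
  rw [fderiv_fun_add hf hh]
  simp only [_root_.add_apply]
  ring

lemma Wd_mul (c : ℂ) (μ : Fin 3) {f h : Pt → ℂ} {z : Pt} (hf : DifferentiableAt ℝ f z)
    (hh : DifferentiableAt ℝ h z) :
    Wd c μ (fun w => f w * h w) z = Wd c μ f z * h z + f z * Wd c μ h z := by
  simp only [Wd]
  rw [fderiv_fun_mul hf hh]
  simp only [_root_.add_apply, _root_.smul_apply, smul_eq_mul]
  ring

lemma Wd_const_mul (c : ℂ) (μ : Fin 3) (k : ℂ) {h : Pt → ℂ} {z : Pt}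
    (hh : DifferentiableAt ℝ h z) :
    Wd c μ (fun w => k * h w) z = k * Wd c μ h z := by
  rw [Wd_mul c μ (differentiableAt_const k) hh, Wd_const]; ring

lemma Wd_sub (c : ℂ) (μ : Fin 3) {f h : Pt → ℂ} {z : Pt} (hf : DifferentiableAt ℝ f z)
    (hh : DifferentiableAt ℝ h z) : Wd c μ (fun w => f w - h w) z = Wd c μ f z - Wd c μ h z := by
  simp only [Wd]
  rw [fderiv_fun_sub hf hh]
  simp only [_root_.sub_apply]
  ring

lemma Wd_neg (c : ℂ) (μ : Fin 3) {h : Pt → ℂ} {z : Pt} :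
    Wd c μ (fun w => - h w) z = - Wd c μ h z := by
  simp only [Wd, fderiv_fun_neg, _root_.neg_apply]
  ring

lemma Wd_sum (c : ℂ) (μ : Fin 3) {f : Fin 3 → Pt → ℂ} {z : Pt}
    (hf : ∀ i, DifferentiableAt ℝ (f i) z) :
    Wd c μ (fun w => ∑ i, f i w) z = ∑ i, Wd c μ (f i) z := by
  simp only [Fin.sum_univ_three]
  rw [Wd_add c μ (f := fun w => f 0 w + f 1 w) ((hf 0).add (hf 1)) (hf 2), Wd_add c μ (hf 0) (hf 1)]

lemma Wd_smooth (c : ℂ) (μ : Fin 3) {f : Pt → ℂ} (hf : ContDiff ℝ (⊤ : ℕ∞) f) :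
    ContDiff ℝ (⊤ : ℕ∞) (Wd c μ f) := by
  have h1 : ContDiff ℝ (⊤ : ℕ∞) (fderiv ℝ f) := hf.fderiv_right (by simp)
  unfold Wd
  exact contDiff_const.mul ((h1.clm_apply contDiff_const).add
    (contDiff_const.mul (h1.clm_apply contDiff_const)))

lemma smooth_diff {f : Pt → ℂ} (hf : ContDiff ℝ (⊤ : ℕ∞) f) (z : Pt) :
    DifferentiableAt ℝ f z := (hf.differentiable (by simp)) z

lemma fderiv_Wd (c : ℂ) (μ : Fin 3) {f : Pt → ℂ} (hf : ContDiff ℝ (⊤ : ℕ∞) f) (z v : Pt) :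
    fderiv ℝ (Wd c μ f) z v = (2⁻¹ : ℂ) * (fderiv ℝ (fderiv ℝ f) z v (EuclideanSpace.single μ 1)
    + c * fderiv ℝ (fderiv ℝ f) z v (EuclideanSpace.single μ Complex.I)) := by
  have h1 : ContDiff ℝ (⊤ : ℕ∞) (fderiv ℝ f) := hf.fderiv_right (by simp)
  have h2 : DifferentiableAt ℝ (fderiv ℝ f) z := (h1.differentiable (by simp)) z
  have e (u : Pt) : HasFDerivAt (fun w => fderiv ℝ f w u)
      ((fderiv ℝ (fderiv ℝ f) z).flip u) z := by
    have := h2.hasFDerivAt.clm_apply (hasFDerivAt_const u z)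
    simpa using this
  have := (((e (EuclideanSpace.single μ 1)).add
    ((e (EuclideanSpace.single μ Complex.I)).const_mul c)).const_mul (2⁻¹ : ℂ)).fderiv
  have h3 : fderiv ℝ (Wd c μ f) z = _ := this
  rw [h3]
  simp
  ring

lemma Wd_comm (c d : ℂ) (μ ν : Fin 3) {f : Pt → ℂ} (hf : ContDiff ℝ (⊤ : ℕ∞) f) (z : Pt) :
    Wd c μ (Wd d ν f) z = Wd d ν (Wd c μ f) z := by
  have hs : IsSymmSndFDerivAt ℝ f z := (hf.contDiffAt).isSymmSndFDerivAt
    (by simp only [minSmoothness_of_isRCLikeNormedField]; exact WithTop.coe_le_coe.2 (le_top : (2 : ℕ∞) ≤ ⊤))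
  have e1 : Wd c μ (Wd d ν f) z = (2⁻¹ : ℂ) * (fderiv ℝ (Wd d ν f) z (EuclideanSpace.single μ 1)
    + c * fderiv ℝ (Wd d ν f) z (EuclideanSpace.single μ Complex.I)) := rfl
  have e2 : Wd d ν (Wd c μ f) z = (2⁻¹ : ℂ) * (fderiv ℝ (Wd c μ f) z (EuclideanSpace.single ν 1)
    + d * fderiv ℝ (Wd c μ f) z (EuclideanSpace.single ν Complex.I)) := rfl
  rw [e1, e2]
  simp only [fderiv_Wd _ _ hf]
  rw [hs (EuclideanSpace.single μ 1) (EuclideanSpace.single ν 1),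
    hs (EuclideanSpace.single μ 1) (EuclideanSpace.single ν Complex.I),
    hs (EuclideanSpace.single μ Complex.I) (EuclideanSpace.single ν 1),
    hs (EuclideanSpace.single μ Complex.I) (EuclideanSpace.single ν Complex.I)]
  ring

lemma Wd_conj (c : ℂ) (μ : Fin 3) {f : Pt → ℂ} {z : Pt} (hf : DifferentiableAt ℝ f z) :
    Wd c μ (fun w => (starRingEnd ℂ) (f w)) z
      = (starRingEnd ℂ) (Wd ((starRingEnd ℂ) c) μ f z) := by
  have h : HasFDerivAt (fun w => (starRingEnd ℂ) (f w))
      ((Complex.conjCLE : ℂ →L[ℝ] ℂ).comp (fderiv ℝ f z)) z :=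
    (Complex.conjCLE : ℂ →L[ℝ] ℂ).hasFDerivAt.comp z hf.hasFDerivAt
  simp only [Wd, h.fderiv]
  simp only [map_mul, map_add, map_inv₀, Complex.conj_conj, map_ofNat]
  rfl

lemma conj_smooth {f : Pt → ℂ} (hf : ContDiff ℝ (⊤ : ℕ∞) f) :
    ContDiff ℝ (⊤ : ℕ∞) (fun w => (starRingEnd ℂ) (f w)) :=
  (Complex.conjCLE : ℂ →L[ℝ] ℂ).contDiff.comp hf

open scoped ComplexOrder in
lemma det_pos_aux (G : Fin 3 → Fin 3 → ℂ) (hherm : ∀ μ ν, (starRingEnd ℂ) (G μ ν) = G ν μ)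
    (hpos : ∀ (v : Fin 3 → ℂ), v ≠ 0 →
      0 < (∑ μ, ∑ ν, G μ ν * v μ * (starRingEnd ℂ) (v ν)).re) :
    0 < Matrix.det (Matrix.of fun μ ν => G μ ν) := by
  apply Matrix.PosDef.det_pos
  apply Matrix.PosDef.of_dotProduct_mulVec_pos
  · ext i j
    simp [Matrix.conjTranspose_apply, hherm]
  · intro x hx
    have key : star x ⬝ᵥ (Matrix.mulVec (Matrix.of fun μ ν => G μ ν) x)
        = ∑ μ, ∑ ν, G μ ν * (star x) μ * (starRingEnd ℂ) ((star x) ν) := by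
      simp only [dotProduct, Matrix.mulVec, Finset.mul_sum]
      refine Finset.sum_congr rfl fun i _ => Finset.sum_congr rfl fun j _ => ?_
      simp; ring
    rw [key]
    have h := hpos (star x) (by simpa using hx)
    rw [Complex.lt_def]
    refine ⟨by simpa using h, ?_⟩
    symm
    rw [Complex.zero_im, ← Complex.conj_eq_iff_im]
    simp only [map_sum, map_mul, hherm, Complex.conj_conj]
    rw [Finset.sum_comm]
    refine Finset.sum_congr rfl fun i _ => Finset.sum_congr rfl fun j _ => ?_
    ring

lemma alg_final (H : Fin 3 → Fin 3 → ℂ) (A B : Fin 3 → Fin 3 → Fin 3 → ℂ)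
    (C : Fin 3 → Fin 3 → Fin 3 → Fin 3 → ℂ) (α β : Fin 3)
    (h1 : 2 * (∑ μ, ∑ ν, (-(∑ c, ∑ b, H μ b * B β c b * H c ν) * A μ α ν + H μ ν * C μ β α ν))
      - (∑ μ, ∑ ν, (-(∑ c, ∑ b, H μ b * B β c b * H c ν) * A α μ ν + H μ ν * C α β μ ν)) = 0)
    (h2 : 2 * (∑ μ, ∑ ν, (-(∑ c, ∑ b, H μ b * A α c b * H c ν) * B ν μ β + H μ ν * C α ν μ β))
      - (∑ μ, ∑ ν, (-(∑ c, ∑ b, H μ b * A α c b * H c ν) * B β μ ν + H μ ν * C α β μ ν)) = 0) :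
    (∑ μ, ∑ ν, H μ ν * (-C μ ν α β + ∑ γ, ∑ σ, H γ σ * A μ α σ * B ν γ β))
     = -(∑ μ, ∑ ν, H μ ν * (C μ ν α β - C μ β α ν - C α ν μ β + C α β μ ν))
      + ∑ μ, ∑ ν, ∑ b, ∑ c, (-A α μ ν + A μ α ν) * H μ b * H c ν * (B b c β - B β c b) := by
  simp only [Fin.sum_univ_three] at *
  linear_combination (-1/2) * h1 + (-1/2) * h2

lemma cof_alg (G H : Fin 3 → Fin 3 → ℂ)
    (h : ∀ σ τ, ∑ α, H α σ * G α τ = (if σ = τ then (1:ℂ) else 0)) (μ ν : Fin 3) :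
    Matrix.det (Matrix.of fun μ ν => G μ ν) * H μ ν
      = Matrix.adjugate (Matrix.of fun μ ν => G μ ν) ν μ := by
  have e : (Matrix.of fun μ ν => G μ ν)⁻¹ = (Matrix.of fun μ ν => H μ ν).transpose := by
    apply Matrix.inv_eq_left_inv
    ext i j
    simp only [Matrix.mul_apply, Matrix.transpose_apply, Matrix.of_apply, h, Matrix.one_apply]
  have hm : (Matrix.of fun μ ν => H μ ν).transpose * (Matrix.of fun μ ν => G μ ν) = 1 := by
    ext i j
    simp only [Matrix.mul_apply, Matrix.transpose_apply, Matrix.of_apply, h, Matrix.one_apply]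
  have hd : Matrix.det (Matrix.of fun μ ν => G μ ν) ≠ 0 := by
    intro h0
    have := congrArg Matrix.det hm
    rw [Matrix.det_mul, h0] at this
    simp at this
  have h2 := congrFun (congrFun e ν) μ
  rw [Matrix.inv_def, Matrix.smul_apply, Ring.inverse_eq_inv', smul_eq_mul] at h2
  have h3 : (Matrix.of fun μ ν => H μ ν).transpose ν μ = H μ ν := rfl
  rw [h3] at h2
  rw [← h2]
  field_simp

lemma detg_fun (g : Fin 3 → Fin 3 → Pt → ℂ) : detg g = fun z =>
    g 0 0 z * g 1 1 z * g 2 2 z - g 0 0 z * g 1 2 z * g 2 1 z - g 0 1 z * g 1 0 z * g 2 2 z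
      + g 0 1 z * g 1 2 z * g 2 0 z + g 0 2 z * g 1 0 z * g 2 1 z
      - g 0 2 z * g 1 1 z * g 2 0 z := by
  funext z
  simp only [detg, Matrix.det_fin_three, Matrix.of_apply]

lemma detg_smooth (g : Fin 3 → Fin 3 → Pt → ℂ) (hg : ∀ μ ν, ContDiff ℝ (⊤ : ℕ∞) (g μ ν)) :
    ContDiff ℝ (⊤ : ℕ∞) (detg g) := by
  rw [detg_fun]
  fun_prop

lemma jacobi (g ginv : Fin 3 → Fin 3 → Pt → ℂ) (hg : ∀ μ ν, ContDiff ℝ (⊤ : ℕ∞) (g μ ν))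
    (hinv2 : ∀ z σ τ, ∑ α, ginv α σ z * g α τ z = (if σ = τ then (1:ℂ) else 0))
    (c : ℂ) (β : Fin 3) (z : Pt) :
    Wd c β (detg g) z = detg g z * ∑ μ, ∑ ν, ginv μ ν z * Wd c β (g μ ν) z := by
  have hd : ∀ μ ν, Differentiable ℝ (g μ ν) := fun μ ν => (hg μ ν).differentiable (by simp)
  have hc := fun μ ν => cof_alg (fun μ ν => g μ ν z) (fun μ ν => ginv μ ν z) (hinv2 z) μ ν
  have e : detg g z * ∑ μ, ∑ ν, ginv μ ν z * Wd c β (g μ ν) z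
      = ∑ μ, ∑ ν, (Matrix.adjugate (Matrix.of fun μ ν => g μ ν z) ν μ) * Wd c β (g μ ν) z := by
    simp only [Finset.mul_sum]
    refine Finset.sum_congr rfl fun i _ => Finset.sum_congr rfl fun j _ => ?_
    rw [← hc, ← mul_assoc]; rfl
  rw [e, detg_fun]
  simp (disch := fun_prop) only [Wd_add, Wd_sub, Wd_mul]
  simp only [Fin.sum_univ_three, Matrix.adjugate_fin_three]
  simp
  ring

lemma wedge_hhaa (g : Fin 3 → Fin 3 → Pt → ℂ) (a b c d : Fin 3) (w : Pt) :
    wedge22 (omF g) (omF g) (Sum.inl a) (Sum.inl b) (Sum.inr c) (Sum.inr d) w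
      = 2 * (g a c w * g b d w - g a d w * g b c w) := by
  simp only [wedge22, omF, Pi.zero_apply]
  linear_combination (2 * g a d w * g b c w - 2 * g a c w * g b d w) * Complex.I_mul_I

lemma wedge_hhha (g : Fin 3 → Fin 3 → Pt → ℂ) (a b c d : Fin 3) (w : Pt) :
    wedge22 (omF g) (omF g) (Sum.inl a) (Sum.inl b) (Sum.inl c) (Sum.inr d) w = 0 := by
  simp only [wedge22, omF, Pi.zero_apply]
  ring

lemma bal (g ginv : Fin 3 → Fin 3 → Pt → ℂ) (N : Pt → ℂ)
    (hg : ∀ μ ν, ContDiff ℝ (⊤ : ℕ∞) (g μ ν)) (hN : ContDiff ℝ (⊤ : ℕ∞) N)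
    (hinv2 : ∀ z σ τ, ∑ α, ginv α σ z * g α τ z = (if σ = τ then (1:ℂ) else 0))
    (hbal : ∀ (a b c d e : Ix) (z : Pt),
      dFour (fun a' b' c' d' w =>
        N w * wedge22 (omF g) (omF g) a' b' c' d' w) a b c d e z = 0) (τ : Fin 3) (z : Pt) :
    ∑ α, Dh α (fun w => N w * detg g w * ginv α τ w) z = 0 := by
  have hd : ∀ μ ν, Differentiable ℝ (g μ ν) := fun μ ν => (hg μ ν).differentiable (by simp)
  have hdN : Differentiable ℝ N := hN.differentiable (by simp)
  have hc : ∀ α, (fun w => N w * detg g w * ginv α τ w) = fun w => N w *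
      Matrix.adjugate (Matrix.of fun μ ν => g μ ν w) τ α := by
    intro α
    funext w
    rw [← cof_alg (fun μ ν => g μ ν w) (fun μ ν => ginv μ ν w) (hinv2 w) α τ, ← mul_assoc]
    rfl
  have h12 := hbal (Sum.inl 0) (Sum.inl 1) (Sum.inl 2) (Sum.inr 1) (Sum.inr 2) z
  have h02 := hbal (Sum.inl 0) (Sum.inl 1) (Sum.inl 2) (Sum.inr 0) (Sum.inr 2) z
  have h01 := hbal (Sum.inl 0) (Sum.inl 1) (Sum.inl 2) (Sum.inr 0) (Sum.inr 1) z
  simp only [dFour, DF, wedge_hhaa, wedge_hhha, mul_zero, Dh_eq, Da_eq, Wd_const] at h12 h02 h01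
  simp only [hc, Dh_eq, Fin.sum_univ_three, Matrix.adjugate_fin_three]
  simp (disch := fun_prop) only [Wd_sub, Wd_mul, Wd_const] at h12 h02 h01
  fin_cases τ
  · simp
    simp (disch := fun_prop) only [Wd_add, Wd_sub, Wd_mul, Wd_neg]
    linear_combination (1/2) * h12
  · simp
    simp (disch := fun_prop) only [Wd_add, Wd_sub, Wd_mul, Wd_neg]
    linear_combination (-1/2) * h02
  · simp
    simp (disch := fun_prop) only [Wd_add, Wd_sub, Wd_mul, Wd_neg]
    linear_combination (1/2) * h01

/-- Contraction identity for the derivative of the inverse metric. -/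
lemma dginv_contr (g ginv : Fin 3 → Fin 3 → Pt → ℂ)
    (hg : ∀ μ ν, ContDiff ℝ (⊤ : ℕ∞) (g μ ν)) (hi : ∀ μ ν, ContDiff ℝ (⊤ : ℕ∞) (ginv μ ν))
    (hinv1 : ∀ z α β, ∑ σ, ginv α σ z * g β σ z = (if α = β then (1:ℂ) else 0))
    (c : ℂ) (κ α β : Fin 3) (z : Pt) :
    ∑ σ, Wd c κ (ginv α σ) z * g β σ z = -∑ σ, ginv α σ z * Wd c κ (g β σ) z := by
  have h0 : Wd c κ (fun w => ∑ σ, ginv α σ w * g β σ w) z = 0 := by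
    simp only [hinv1, Wd_const]
  rw [Wd_sum c κ (fun σ => (smooth_diff (hi α σ) z).fun_mul (smooth_diff (hg β σ) z))] at h0
  simp only [Wd_mul c κ (smooth_diff (hi _ _) z) (smooth_diff (hg _ _) z),
    Finset.sum_add_distrib] at h0
  linear_combination h0

lemma dginv (g ginv : Fin 3 → Fin 3 → Pt → ℂ)
    (hg : ∀ μ ν, ContDiff ℝ (⊤ : ℕ∞) (g μ ν)) (hi : ∀ μ ν, ContDiff ℝ (⊤ : ℕ∞) (ginv μ ν))
    (hinv1 : ∀ z α β, ∑ σ, ginv α σ z * g β σ z = (if α = β then (1:ℂ) else 0))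
    (hinv2 : ∀ z σ τ, ∑ α, ginv α σ z * g α τ z = (if σ = τ then (1:ℂ) else 0))
    (d : ℂ) (κ μ ν : Fin 3) (z : Pt) :
    Wd d κ (ginv μ ν) z = -(∑ c, ∑ b, ginv μ b z * Wd d κ (g c b) z * ginv c ν z) := by
  have h := fun c => dginv_contr g ginv hg hi hinv1 d κ μ c z
  have e1 : ∑ c, (∑ σ, Wd d κ (ginv μ σ) z * g c σ z) * ginv c ν z = Wd d κ (ginv μ ν) z := by
    have : ∀ σ, ∑ c, Wd d κ (ginv μ σ) z * g c σ z * ginv c ν z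
        = if ν = σ then Wd d κ (ginv μ σ) z else 0 := by
      intro σ
      have := congrArg (fun x => Wd d κ (ginv μ σ) z * x) (hinv2 z ν σ)
      simp only [Finset.mul_sum, mul_ite, mul_one, mul_zero] at this
      rw [← this]
      exact Finset.sum_congr rfl fun i _ => by ring
    simp only [Finset.sum_mul]
    rw [Finset.sum_comm]
    simp only [this, Finset.sum_ite_eq, Finset.mem_univ, if_true]
  rw [← e1]
  simp only [h, neg_mul, Finset.sum_neg_distrib, Finset.sum_mul]

lemma nrm_facts (g : Fin 3 → Fin 3 → Pt → ℂ) (f : Pt → ℂ)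
    (hg : ∀ μ ν, ContDiff ℝ (⊤ : ℕ∞) (g μ ν))
    (hherm : ∀ μ ν z, (starRingEnd ℂ) (g μ ν z) = g ν μ z)
    (hpos : ∀ z (v : Fin 3 → ℂ), v ≠ 0 →
      0 < (∑ μ, ∑ ν, g μ ν z * v μ * (starRingEnd ℂ) (v ν)).re)
    (hf : ContDiff ℝ (⊤ : ℕ∞) f) (hfne : ∀ z, f z ≠ 0) :
    ContDiff ℝ (⊤ : ℕ∞) (fun w => (nrmOm g f w : ℂ)) ∧ (∀ z, detg g z ≠ 0) ∧
    ∀ z, (nrmOm g f z : ℂ) * (nrmOm g f z : ℂ) * detg g z = f z * (starRingEnd ℂ) (f z) := by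
  have hD : ∀ z, 0 < (detg g z).re ∧ (detg g z).im = 0 := by
    intro z
    have h := det_pos_aux (fun μ ν => g μ ν z) (fun μ ν => hherm μ ν z) (hpos z)
    rw [Complex.lt_def] at h
    exact ⟨by simpa [detg] using h.1, by simpa [detg] using h.2.symm⟩
  have hDs := detg_smooth g hg
  have hre : ContDiff ℝ (⊤ : ℕ∞) (fun w => (detg g w).re) := Complex.reCLM.contDiff.comp hDs
  have hfr : ContDiff ℝ (⊤ : ℕ∞) (fun w => (f w).re) := Complex.reCLM.contDiff.comp hf
  have hfi : ContDiff ℝ (⊤ : ℕ∞) (fun w => (f w).im) := Complex.imCLM.contDiff.comp hf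
  have hns : ContDiff ℝ (⊤ : ℕ∞) (fun w => Complex.normSq (f w)) := by
    simp only [Complex.normSq_apply]
    exact (hfr.mul hfr).add (hfi.mul hfi)
  have hq : ∀ z, 0 < Complex.normSq (f z) / (detg g z).re := fun z =>
    div_pos (Complex.normSq_pos.2 (hfne z)) (hD z).1
  refine ⟨?_, ?_, ?_⟩
  · have h1 : ContDiff ℝ (⊤ : ℕ∞) (nrmOm g f) :=
      (hns.div hre (fun z => (hD z).1.ne')).sqrt (fun z => (hq z).ne')
    exact Complex.ofRealCLM.contDiff.comp h1
  · intro z h0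
    have := (hD z).1
    rw [h0] at this
    simp at this
  · intro z
    have h1 : nrmOm g f z * nrmOm g f z = Complex.normSq (f z) / (detg g z).re :=
      Real.mul_self_sqrt (hq z).le
    have h2 : detg g z = ((detg g z).re : ℂ) := by
      apply Complex.ext <;> simp [(hD z).2]
    have h3 : nrmOm g f z * nrmOm g f z * (detg g z).re = Complex.normSq (f z) := by
      rw [h1]; field_simp [(hD z).1.ne']
    rw [Complex.mul_conj, ← h3, h2]
    push_cast
    simp

/-- The balanced condition solved for the trace of the Chern connection. -/
lemma keyU (g ginv : Fin 3 → Fin 3 → Pt → ℂ) (f N : Pt → ℂ)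
    (hg : ∀ μ ν, ContDiff ℝ (⊤ : ℕ∞) (g μ ν)) (hi : ∀ μ ν, ContDiff ℝ (⊤ : ℕ∞) (ginv μ ν))
    (hinv1 : ∀ z α β, ∑ σ, ginv α σ z * g β σ z = (if α = β then (1:ℂ) else 0))
    (hinv2 : ∀ z σ τ, ∑ α, ginv α σ z * g α τ z = (if σ = τ then (1:ℂ) else 0))
    (hf : ContDiff ℝ (⊤ : ℕ∞) f) (hfhol : ∀ μ z, Da μ f z = 0) (hfne : ∀ z, f z ≠ 0)
    (hN : ContDiff ℝ (⊤ : ℕ∞) N) (hD : ∀ z, detg g z ≠ 0)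
    (hND : ∀ z, N z * N z * detg g z = f z * (starRingEnd ℂ) (f z))
    (hb : ∀ τ z, ∑ α, Dh α (fun w => N w * detg g w * ginv α τ w) z = 0) (β : Fin 3) (z : Pt) :
    (2 * (∑ μ, ∑ ν, ginv μ ν z * Dh μ (g β ν) z) - ∑ μ, ∑ ν, ginv μ ν z * Dh β (g μ ν) z) * f z
      = Dh β f z := by
  have hDs := detg_smooth g hg
  have hP : ContDiff ℝ (⊤ : ℕ∞) (fun w => N w * detg g w) := hN.mul hDs
  set P : Pt → ℂ := fun w => N w * detg g w with hPdef
  have hfc := conj_smooth hf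
  have hfcz : Dh β (fun w => (starRingEnd ℂ) (f w)) z = 0 := by
    rw [Dh_eq, Wd_conj _ _ (smooth_diff hf z)]
    have := hfhol β z
    rw [Da_eq] at this
    simp [this]
  -- first: derivative of P
  have h1 : Dh β P z = P z * ∑ μ, ∑ ν, ginv μ ν z * Dh μ (g β ν) z := by
    have hb' : ∀ τ, ∑ α, (Dh α P z * ginv α τ z + P z * Dh α (ginv α τ) z) = 0 := by
      intro τ
      rw [← hb τ z]
      refine Finset.sum_congr rfl fun α _ => ?_
      simp only [Dh_eq]
      exact (Wd_mul _ _ (smooth_diff hP z) (smooth_diff (hi α τ) z)).symm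
    have hs : ∑ τ, (∑ α, (Dh α P z * ginv α τ z + P z * Dh α (ginv α τ) z)) * g β τ z = 0 := by
      simp only [hb', zero_mul, Finset.sum_const_zero]
    have e : ∑ τ, (∑ α, (Dh α P z * ginv α τ z + P z * Dh α (ginv α τ) z)) * g β τ z
        = ∑ α, (Dh α P z * (∑ τ, ginv α τ z * g β τ z)
          + P z * (∑ τ, Dh α (ginv α τ) z * g β τ z)) := by
      simp only [Fin.sum_univ_three]; ring
    rw [e] at hs
    simp only [Dh_eq] at hs ⊢
    simp only [dginv_contr g ginv hg hi hinv1, hinv1] at hs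
    simp only [mul_ite, mul_one, mul_zero, mul_neg, Finset.sum_add_distrib,
      Finset.sum_ite_eq', Finset.mem_univ, if_true, Finset.sum_neg_distrib,
      ← Finset.mul_sum] at hs
    linear_combination hs
  have h2 : (fun w => P w * P w) = fun w => (f w * (starRingEnd ℂ) (f w)) * detg g w := by
    funext w
    rw [← hND w, hPdef]; ring
  have h3 := congrArg (fun F => Dh β F z) h2
  have hJ := jacobi g ginv hg hinv2 (-Complex.I) β z
  rw [← Dh_eq] at hJ
  simp only [Dh_eq] at h3 hfcz h1 hJ ⊢
  rw [Wd_mul _ _ (smooth_diff hP z) (smooth_diff hP z),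
    Wd_mul _ _ (smooth_diff (hf.mul hfc) z) (smooth_diff hDs z),
    Wd_mul _ _ (smooth_diff hf z) (smooth_diff hfc z), hfcz, h1, hJ] at h3
  have h2z : P z * P z = (f z * (starRingEnd ℂ) (f z)) * detg g z := congrFun h2 z
  have hne : (starRingEnd ℂ) (f z) * detg g z ≠ 0 :=
    mul_ne_zero (by simpa using hfne z) (hD z)
  apply mul_left_cancel₀ hne
  linear_combination h3 - 2 * (∑ μ, ∑ ν, ginv μ ν z * Wd (-Complex.I) μ (g β ν) z) * h2z

lemma ginv_conj (g ginv : Fin 3 → Fin 3 → Pt → ℂ)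
    (hherm : ∀ μ ν z, (starRingEnd ℂ) (g μ ν z) = g ν μ z)
    (hinv1 : ∀ z α β, ∑ σ, ginv α σ z * g β σ z = (if α = β then (1:ℂ) else 0))
    (hinv2 : ∀ z σ τ, ∑ α, ginv α σ z * g α τ z = (if σ = τ then (1:ℂ) else 0))
    (μ ν : Fin 3) (z : Pt) : (starRingEnd ℂ) (ginv μ ν z) = ginv ν μ z := by
  -- conj of `hinv1` : `∑ conj (ginv μ σ) g σ β = δ`
  have h1 : ∀ β, ∑ σ, (starRingEnd ℂ) (ginv μ σ z) * g σ β z = if μ = β then (1:ℂ) else 0 := by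
    intro β
    have := congrArg (starRingEnd ℂ) (hinv1 z μ β)
    simp only [map_sum, map_mul, hherm] at this
    rw [this]; split_ifs <;> simp
  have e : ∑ β, (∑ σ, (starRingEnd ℂ) (ginv μ σ z) * g σ β z) * ginv ν β z
      = ∑ σ, (starRingEnd ℂ) (ginv μ σ z) * ∑ β, ginv ν β z * g σ β z := by
    simp only [Fin.sum_univ_three]; ring
  simp only [h1, hinv1] at e
  simpa using e.symm

lemma keyV (g ginv : Fin 3 → Fin 3 → Pt → ℂ) (f : Pt → ℂ)
    (hg : ∀ μ ν, ContDiff ℝ (⊤ : ℕ∞) (g μ ν))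
    (hherm : ∀ μ ν z, (starRingEnd ℂ) (g μ ν z) = g ν μ z)
    (hgc : ∀ μ ν z, (starRingEnd ℂ) (ginv μ ν z) = ginv ν μ z)
    (hf : ContDiff ℝ (⊤ : ℕ∞) f) (β : Fin 3) (z : Pt)
    (hU : (2 * (∑ μ, ∑ ν, ginv μ ν z * Dh μ (g β ν) z)
      - ∑ μ, ∑ ν, ginv μ ν z * Dh β (g μ ν) z) * f z = Dh β f z) :
    (2 * (∑ μ, ∑ ν, ginv μ ν z * Da ν (g μ β) z)
      - ∑ μ, ∑ ν, ginv μ ν z * Da β (g μ ν) z) * (starRingEnd ℂ) (f z)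
      = Da β (fun w => (starRingEnd ℂ) (f w)) z := by
  have hc : ∀ κ μ ν, (starRingEnd ℂ) (Dh κ (g μ ν) z) = Da κ (g ν μ) z := by
    intro κ μ ν
    have : g ν μ = fun w => (starRingEnd ℂ) (g μ ν w) := by
      funext w; rw [hherm]
    rw [this, Da_eq, Wd_conj _ _ (smooth_diff (hg μ ν) z), Dh_eq]
    simp
  have hcf : (starRingEnd ℂ) (Dh β f z) = Da β (fun w => (starRingEnd ℂ) (f w)) z := by
    rw [Da_eq, Wd_conj _ _ (smooth_diff hf z), Dh_eq]
    simp
  have := congrArg (starRingEnd ℂ) hU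
  simp only [map_sum, map_mul, map_sub, map_ofNat, hgc, hc, hcf] at this
  rw [← this]
  simp only [Fin.sum_univ_three]
  ring

/-- If `F f = ∂f` with `f` annihilated by the other derivative, so is `F`. -/
lemma logder (c d : ℂ) (α β : Fin 3) (F f : Pt → ℂ) (hF : ContDiff ℝ (⊤ : ℕ∞) F)
    (hf : ContDiff ℝ (⊤ : ℕ∞) f) (hfne : ∀ z, f z ≠ 0)
    (h0 : ∀ z, Wd d β f z = 0) (h : ∀ z, F z * f z = Wd c α f z) (z : Pt) : Wd d β F z = 0 := by
  have e : (fun w => F w * f w) = Wd c α f := funext h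
  have e0 : Wd d β f = fun _ => 0 := funext h0
  have h1 := congrArg (fun G => Wd d β G z) e
  beta_reduce at h1
  rw [Wd_mul _ _ (smooth_diff hF z) (smooth_diff hf z), Wd_comm _ _ _ _ hf, h0, e0, Wd_const] at h1
  simpa [hfne z] using h1

lemma Wd_ssum (c : ℂ) (κ : Fin 3) (p q : Fin 3 → Fin 3 → Pt → ℂ)
    (hp : ∀ μ ν, ContDiff ℝ (⊤ : ℕ∞) (p μ ν)) (hq : ∀ μ ν, ContDiff ℝ (⊤ : ℕ∞) (q μ ν)) (z : Pt) :
    Wd c κ (fun w => ∑ μ, ∑ ν, p μ ν w * q μ ν w) z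
      = ∑ μ, ∑ ν, (Wd c κ (p μ ν) z * q μ ν z + p μ ν z * Wd c κ (q μ ν) z) := by
  have hd : ∀ μ ν, DifferentiableAt ℝ (fun w => p μ ν w * q μ ν w) z := fun μ ν =>
    (smooth_diff (hp μ ν) z).mul (smooth_diff (hq μ ν) z)
  rw [Wd_sum c κ (fun μ => DifferentiableAt.fun_sum fun ν _ => hd μ ν)]
  refine Finset.sum_congr rfl fun μ _ => ?_
  rw [Wd_sum c κ (fun ν => hd μ ν)]
  exact Finset.sum_congr rfl fun ν _ =>
    Wd_mul c κ (smooth_diff (hp μ ν) z) (smooth_diff (hq μ ν) z)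

lemma tor_hha (g : Fin 3 → Fin 3 → Pt → ℂ) (hg : ∀ μ ν, ContDiff ℝ (⊤ : ℕ∞) (g μ ν))
    (a b c : Fin 3) (z : Pt) :
    TorF g (Sum.inl a) (Sum.inl b) (Sum.inr c) z
      = -Wd (-Complex.I) a (g b c) z + Wd (-Complex.I) b (g a c) z := by
  have h0 : ∀ (k : ℂ) (μ : Fin 3), Wd k μ 0 z = 0 := fun k μ => Wd_const k μ 0 z
  simp only [TorF, dTwo, DF, omF, nHol, Dh_eq, Da_eq, h0,
    Wd_const_mul _ _ _ (smooth_diff (hg _ _) z)]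
  norm_num
  linear_combination (Wd (-Complex.I) a (g b c) z - Wd (-Complex.I) b (g a c) z) * Complex.I_mul_I

lemma tor_aha (g : Fin 3 → Fin 3 → Pt → ℂ) (hg : ∀ μ ν, ContDiff ℝ (⊤ : ℕ∞) (g μ ν))
    (b c β : Fin 3) (z : Pt) :
    TorF g (Sum.inr b) (Sum.inl c) (Sum.inr β) z
      = Wd Complex.I b (g c β) z - Wd Complex.I β (g c b) z := by
  have h0 : ∀ (k : ℂ) (μ : Fin 3), Wd k μ 0 z = 0 := fun k μ => Wd_const k μ 0 z
  simp only [TorF, dTwo, DF, omF, nHol, Dh_eq, Da_eq, h0, Wd_neg,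
    Wd_const_mul _ _ _ (smooth_diff (hg _ _) z)]
  norm_num
  linear_combination (-Wd Complex.I b (g c β) z + Wd Complex.I β (g c b) z) * Complex.I_mul_I

lemma iddbar_eq (g : Fin 3 → Fin 3 → Pt → ℂ) (hg : ∀ μ ν, ContDiff ℝ (⊤ : ℕ∞) (g μ ν))
    (μ ν α β : Fin 3) (z : Pt) :
    iddbarOm g (Sum.inl μ) (Sum.inr ν) (Sum.inr β) (Sum.inl α) z
      = Wd (-Complex.I) μ (Wd Complex.I ν (g α β)) z - Wd (-Complex.I) μ (Wd Complex.I β (g α ν)) z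
       - Wd (-Complex.I) α (Wd Complex.I ν (g μ β)) z
       + Wd (-Complex.I) α (Wd Complex.I β (g μ ν)) z := by
  have h0 : ∀ (k : ℂ) (μ : Fin 3) (z : Pt), Wd k μ 0 z = 0 := fun k μ z => Wd_const k μ 0 z
  have e1 : pbarOm g (Sum.inr ν) (Sum.inr β) (Sum.inl α)
      = fun w => (-Complex.I) * (Wd Complex.I ν (g α β) w - Wd Complex.I β (g α ν) w) := by
    funext w
    simp only [pbarOm, dTwo, DF, omF, nHol, Dh_eq, Da_eq, h0, Wd_neg,
      Wd_const_mul _ _ _ (smooth_diff (hg _ _) w)]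
    norm_num
    ring
  have e2 : pbarOm g (Sum.inl μ) (Sum.inr β) (Sum.inl α) = fun _ => 0 := by
    funext w; simp [pbarOm, nHol]
  have e3 : pbarOm g (Sum.inl μ) (Sum.inr ν) (Sum.inl α) = fun _ => 0 := by
    funext w; simp [pbarOm, nHol]
  have e4 : pbarOm g (Sum.inl μ) (Sum.inr ν) (Sum.inr β)
      = fun w => (-Complex.I) * (Wd Complex.I ν (g μ β) w - Wd Complex.I β (g μ ν) w) := by
    funext w
    simp only [pbarOm, dTwo, DF, omF, nHol, Dh_eq, Da_eq, h0, Wd_neg,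
      Wd_const_mul _ _ _ (smooth_diff (hg _ _) w)]
    norm_num
    ring
  have hs : ∀ κ a b, DifferentiableAt ℝ (Wd Complex.I κ (g a b)) z := fun κ a b =>
    smooth_diff (Wd_smooth _ _ (hg a b)) z
  simp only [iddbarOm, dThree, DF, nHol, e1, e2, e3, e4, Dh_eq, Da_eq, Wd_const]
  rw [Wd_const_mul _ _ _ ((hs _ _ _).fun_sub (hs _ _ _)), Wd_sub _ _ (hs _ _ _) (hs _ _ _),
    Wd_const_mul _ _ _ ((hs _ _ _).fun_sub (hs _ _ _)), Wd_sub _ _ (hs _ _ _) (hs _ _ _)]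
  norm_num
  linear_combination (-(Wd (-Complex.I) μ (Wd Complex.I ν (g α β)) z
    - Wd (-Complex.I) μ (Wd Complex.I β (g α ν)) z
       - Wd (-Complex.I) α (Wd Complex.I ν (g μ β)) z
       + Wd (-Complex.I) α (Wd Complex.I β (g μ ν)) z)) * Complex.I_mul_I

lemma curv (g ginv : Fin 3 → Fin 3 → Pt → ℂ)
    (hg : ∀ μ ν, ContDiff ℝ (⊤ : ℕ∞) (g μ ν)) (hi : ∀ μ ν, ContDiff ℝ (⊤ : ℕ∞) (ginv μ ν))
    (hinv2 : ∀ z σ τ, ∑ α, ginv α σ z * g α τ z = (if σ = τ then (1:ℂ) else 0))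
    (μ ν α β : Fin 3) (z : Pt) :
    ∑ γ, RCH g ginv μ ν γ α z * g γ β z
      = -Wd (-Complex.I) μ (Wd Complex.I ν (g α β)) z
        + ∑ γ, ∑ σ, ginv γ σ z * Wd (-Complex.I) μ (g α σ) z * Wd Complex.I ν (g γ β) z := by
  have hG : ∀ γ, ContDiff ℝ (⊤ : ℕ∞) (GamCH g ginv μ γ α) := by
    intro γ
    unfold GamCH
    rw [Dh_eq]
    exact ContDiff.sum fun σ _ => (hi γ σ).mul (Wd_smooth _ _ (hg α σ))
  have e : (fun w => ∑ γ, GamCH g ginv μ γ α w * g γ β w) = Wd (-Complex.I) μ (g α β) := by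
    funext w
    have : ∑ γ, GamCH g ginv μ γ α w * g γ β w
        = ∑ σ, (∑ γ, ginv γ σ w * g γ β w) * Wd (-Complex.I) μ (g α σ) w := by
      simp only [GamCH, Dh_eq, Fin.sum_univ_three]; ring
    rw [this]
    simp only [hinv2]
    simp
  have h1 := congrArg (fun F => Wd Complex.I ν F z) e
  beta_reduce at h1
  rw [Wd_sum _ _ (fun γ => (smooth_diff (hG γ) z).fun_mul (smooth_diff (hg γ β) z)),
    Wd_comm _ _ _ _ (hg α β)] at h1
  simp only [Wd_mul _ _ (smooth_diff (hG _) z) (smooth_diff (hg _ β) z)] at h1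
  rw [← h1]
  simp only [RCH, Da_eq, GamCH, Dh_eq, Fin.sum_univ_three]
  ring

theorem stmt9 (g ginv : Fin 3 → Fin 3 → Pt → ℂ) (f : Pt → ℂ)
    -- the metric components are smooth
    (hg : ∀ μ ν, ContDiff ℝ (⊤ : ℕ∞) (g μ ν)) (hginvsm : ∀ μ ν, ContDiff ℝ (⊤ : ℕ∞) (ginv μ ν))
    -- hermitian: `conj g_{μν̄} = g_{νμ̄}`, and positive
    (hherm : ∀ μ ν z, (starRingEnd ℂ) (g μ ν z) = g ν μ z)
    (hpos : ∀ z (v : Fin 3 → ℂ), v ≠ 0 →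
      0 < (∑ μ, ∑ ν, g μ ν z * v μ * (starRingEnd ℂ) (v ν)).re)
    -- `ginv` is the inverse metric: `g^{ασ̄} g_{βσ̄} = δ^α_β` and `g^{ασ̄} g_{ατ̄} = δ^σ̄_τ̄`
    (hinv1 : ∀ z α β, ∑ σ, ginv α σ z * g β σ z = (if α = β then (1:ℂ) else 0))
    (hinv2 : ∀ z σ τ, ∑ α, ginv α σ z * g α τ z = (if σ = τ then (1:ℂ) else 0))
    -- `Ω = f dz¹²³` is a holomorphic volume form: `f` is holomorphic and nonvanishing
    (hf : ContDiff ℝ (⊤ : ℕ∞) f)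
    (hfhol : ∀ μ z, Da μ f z = 0)
    (hfne : ∀ z, f z ≠ 0)
    -- the conformally balanced condition `d(‖Ω‖_ω ω²) = 0`
    (hbal : ∀ (a b c d e : Ix) (z : Pt),
      dFour (fun a' b' c' d' w =>
        (nrmOm g f w : ℂ) * wedge22 (omF g) (omF g) a' b' c' d' w) a b c d e z = 0) :
    -- conclusion: `R^{CH}{}_μ{}^μ{}_{β̄α} = −(i∂∂̄ω)_μ{}^μ{}_{β̄α} + T_{αμν̄} T^{μν̄}{}_{β̄}`
    ∀ (z : Pt) (α β : Fin 3),
      (∑ μ, ∑ ν, ∑ γ, ginv μ ν z * RCH g ginv μ ν γ α z * g γ β z)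
        = -(∑ μ, ∑ ν, ginv μ ν z *
              iddbarOm g (Sum.inl μ) (Sum.inr ν) (Sum.inr β) (Sum.inl α) z)
          + (∑ μ, ∑ ν, ∑ b, ∑ c,
              TorF g (Sum.inl α) (Sum.inl μ) (Sum.inr ν) z * ginv μ b z * ginv c ν z *
                TorF g (Sum.inr b) (Sum.inl c) (Sum.inr β) z) := by
  intro z α β
  obtain ⟨hN, hD, hND⟩ := nrm_facts g f hg hherm hpos hf hfne
  have hb := fun τ z => bal g ginv (fun w => (nrmOm g f w : ℂ)) hg hN hinv2 hbal τ z
  have hU := fun β z => keyU g ginv f (fun w => (nrmOm g f w : ℂ)) hg hginvsm hinv1 hinv2 hf hfhol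
    hfne hN hD hND hb β z
  have hgc := fun μ ν z => ginv_conj g ginv hherm hinv1 hinv2 μ ν z
  have hV := fun β z => keyV g ginv f hg hherm hgc hf β z (hU β z)
  have hfc := conj_smooth hf
  have hfcz : ∀ κ z, Wd (-Complex.I) κ (fun w => (starRingEnd ℂ) (f w)) z = 0 := by
    intro κ z
    rw [Wd_conj _ _ (smooth_diff hf z)]
    have := hfhol κ z
    rw [Da_eq] at this
    simp [this]
  simp only [Dh_eq, Da_eq] at hU hV hfhol
  have hsm : ∀ (c : ℂ) (κ a b : Fin 3), ContDiff ℝ (⊤ : ℕ∞) (Wd c κ (g a b)) :=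
    fun c κ a b => Wd_smooth c κ (hg a b)
  have hS : ∀ (q : Fin 3 → Fin 3 → Pt → ℂ), (∀ μ ν, ContDiff ℝ (⊤ : ℕ∞) (q μ ν)) →
      ContDiff ℝ (⊤ : ℕ∞) (fun w => ∑ μ, ∑ ν, ginv μ ν w * q μ ν w) := fun q hq =>
    ContDiff.sum fun μ _ => ContDiff.sum fun ν _ => (hginvsm μ ν).mul (hq μ ν)
  have hS1 := hS (fun μ ν => Wd (-Complex.I) μ (g α ν)) (fun μ ν => hsm _ _ _ _)
  have hS2 := hS (fun μ ν => Wd (-Complex.I) α (g μ ν)) (fun μ ν => hsm _ _ _ _)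
  have hS3 := hS (fun μ ν => Wd Complex.I ν (g μ β)) (fun μ ν => hsm _ _ _ _)
  have hS4 := hS (fun μ ν => Wd Complex.I β (g μ ν)) (fun μ ν => hsm _ _ _ _)
  have h1 := logder (-Complex.I) Complex.I α β _ f ((contDiff_const.mul hS1).sub hS2) hf hfne
    (hfhol β) (hU α) z
  have h2 := logder Complex.I (-Complex.I) β α _ _ ((contDiff_const.mul hS3).sub hS4) hfc
    (fun z => by simpa using hfne z) (hfcz α) (hV β) z
  rw [Wd_sub _ _ (smooth_diff (contDiff_const.mul hS1) z) (smooth_diff hS2 z),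
    Wd_const_mul _ _ _ (smooth_diff hS1 z), Wd_ssum _ _ _ _ hginvsm (fun μ ν => hsm _ _ _ _),
    Wd_ssum _ _ _ _ hginvsm (fun μ ν => hsm _ _ _ _)] at h1
  rw [Wd_sub _ _ (smooth_diff (contDiff_const.mul hS3) z) (smooth_diff hS4 z),
    Wd_const_mul _ _ _ (smooth_diff hS3 z), Wd_ssum _ _ _ _ hginvsm (fun μ ν => hsm _ _ _ _),
    Wd_ssum _ _ _ _ hginvsm (fun μ ν => hsm _ _ _ _)] at h2
  simp only [dginv g ginv hg hginvsm hinv1 hinv2,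
    Wd_comm Complex.I (-Complex.I) _ _ (hg _ _)] at h1
  simp only [dginv g ginv hg hginvsm hinv1 hinv2] at h2
  have key := alg_final (fun μ ν => ginv μ ν z) (fun κ μ ν => Wd (-Complex.I) κ (g μ ν) z)
    (fun κ μ ν => Wd Complex.I κ (g μ ν) z)
    (fun κ l μ ν => Wd (-Complex.I) κ (Wd Complex.I l (g μ ν)) z) α β h1 h2
  simp only [tor_hha g hg, tor_aha g hg, iddbar_eq g hg]
  rw [← key]
  refine Finset.sum_congr rfl fun μ _ => Finset.sum_congr rfl fun ν _ => ?_
  rw [← curv g ginv hg hginvsm hinv2 μ ν α β z, Finset.mul_sum]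
  exact Finset.sum_congr rfl fun γ _ => by ring
end
end

section
/- On a hermitian complex threefold (X,ω), every 3-form χ satisfies ⋆χ = Jχ − J(Λ_ω χ) ∧ ω, where ⋆ is the Hodge star of the metric ω and J acts on differential forms by duality (J dx^μ = i dx^μ, J dx^μ̄ = −i dx^μ̄). -/
noncomputable section

/-!
# Statement 12

On a hermitian complex threefold `(X,ω)`, every 3-form `χ` satisfies
`⋆χ = Jχ − J(Λ_ω χ) ∧ ω`, where `⋆` is the Hodge star of the metric `ω` (with volume form
`ω³/3!`) and `J` acts on differential forms by duality (`J dz^μ = i dz^μ`,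
`J dz̄^μ = −i dz̄^μ`).

Formalised on the local model `ℂ³`; the identity is pointwise.
-/
open scoped BigOperators

/-- The contraction operator `(iΛ_ω η)_K = g^{μν̄} η_{μν̄K}` on 3-forms. -/
def iLam3 (ginv : Fin 3 → Fin 3 → Pt → ℂ) (η : Ix → Ix → Ix → Pt → ℂ) (k : Ix) :
    Pt → ℂ := fun z =>
  ∑ μ, ∑ ν, ginv μ ν z * η (Sum.inl μ) (Sum.inr ν) k z

/-- The operator `Λ_ω = −i ⋅ (iΛ_ω)` on 3-forms. -/
def Lam3 (ginv : Fin 3 → Fin 3 → Pt → ℂ) (η : Ix → Ix → Ix → Pt → ℂ) (k : Ix) :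
    Pt → ℂ := fun z =>
  -Complex.I * iLam3 ginv η k z

/-- The sign of a permutation, as a complex number. -/
def sgn {n : ℕ} (σ : Equiv.Perm (Fin n)) : ℂ := ((Equiv.Perm.sign σ : ℤ) : ℂ)

/-- Components of the wedge product of a 1-form and a 4-form. -/
def wedge14 (a : Ix → Pt → ℂ) (B : Ix → Ix → Ix → Ix → Pt → ℂ) (v : Fin 5 → Ix) :
    Pt → ℂ := fun z =>
  (24⁻¹ : ℂ) * ∑ σ : Equiv.Perm (Fin 5),
    sgn σ * a (v (σ 0)) z * B (v (σ 1)) (v (σ 2)) (v (σ 3)) (v (σ 4)) z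

/-- Components of the wedge product of three 2-forms. -/
def wedge222 (A B C : Ix → Ix → Pt → ℂ) (v : Fin 6 → Ix) : Pt → ℂ := fun z =>
  (8⁻¹ : ℂ) * ∑ σ : Equiv.Perm (Fin 6),
    sgn σ * A (v (σ 0)) (v (σ 1)) z * B (v (σ 2)) (v (σ 3)) z * C (v (σ 4)) (v (σ 5)) z

/-- The volume form `ω³/3!` of the hermitian metric. -/
def volOm (g : Fin 3 → Fin 3 → Pt → ℂ) (v : Fin 6 → Ix) : Pt → ℂ := fun z =>
  (6⁻¹ : ℂ) * wedge222 (omF g) (omF g) (omF g) v z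

/-- The Hodge star of a 3-form, `(⋆χ)_{mnp} = (1/3!) χ^{qrs} Vol_{qrsmnp}`, with the
volume form `ω³/3!`. -/
def hstar (g ginv : Fin 3 → Fin 3 → Pt → ℂ) (χ : Ix → Ix → Ix → Pt → ℂ)
    (m n p : Ix) : Pt → ℂ := fun z =>
  (6⁻¹ : ℂ) * ∑ q, ∑ r, ∑ s, ∑ q', ∑ r', ∑ s',
    ginvF ginv q q' z * ginvF ginv r r' z * ginvF ginv s s' z * χ q' r' s' z *
      volOm g ![q, r, s, m, n, p] z

/-- The factor by which `J` acts on a (co)tangent index. -/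
def jfac : Ix → ℂ
  | Sum.inl _ => Complex.I
  | Sum.inr _ => -Complex.I

/-- Components of the wedge product of a 1-form and a 2-form. -/
def wedge12 (a : Ix → Pt → ℂ) (B : Ix → Ix → Pt → ℂ) (m n p : Ix) : Pt → ℂ := fun z =>
  a m z * B n p z - a n z * B m p z + a p z * B m n z


/-- Signed sum over permutations: the antisymmetrizer. -/
def asym {n : ℕ} (f : (Fin n → Ix) → ℂ) (v : Fin n → Ix) : ℂ :=
  ∑ σ : Equiv.Perm (Fin n), sgn σ * f (fun i => v (σ i))

theorem asym_comp {n : ℕ} (f : (Fin n → Ix) → ℂ) (v : Fin n → Ix) (τ : Equiv.Perm (Fin n)) :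
    asym f (fun i => v (τ i)) = sgn τ * asym f v := by
  unfold asym
  rw [Finset.mul_sum]
  refine Fintype.sum_equiv (Equiv.mulLeft τ) _ _ (fun σ => ?_)
  have h : sgn τ * sgn τ = 1 := by
    unfold sgn
    rcases Int.units_eq_one_or (Equiv.Perm.sign τ) with h | h <;> simp [h]
  have h2 : sgn (τ * σ) = sgn τ * sgn σ := by simp [sgn]
  simp only [Equiv.coe_mulLeft, h2, Equiv.Perm.mul_apply]
  linear_combination (-(sgn σ * f (fun i => v (τ (σ i))))) * h

theorem asym_swap {n : ℕ} (f : (Fin n → Ix) → ℂ) (v w : Fin n → Ix) (i j : Fin n) (hij : i ≠ j)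
    (h : ∀ k, w k = v (Equiv.swap i j k)) : asym f w = - asym f v := by
  have : w = fun k => v (Equiv.swap i j k) := funext h
  rw [this, asym_comp]
  simp [sgn, Equiv.Perm.sign_swap hij]

theorem asym_succ {n : ℕ} (f : (Fin (n+1) → Ix) → ℂ) (v : Fin (n+1) → Ix) :
    asym f v = ∑ p : Fin (n+1), (if p = 0 then 1 else -1) *
      asym (fun w => f (Fin.cons (v p) w)) (fun i => v (Equiv.swap 0 p i.succ)) := by
  unfold asym
  rw [← Equiv.sum_comp Equiv.Perm.decomposeFin.symm, Fintype.sum_prod_type]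
  refine Finset.sum_congr rfl (fun p _ => ?_)
  rw [Finset.mul_sum]
  refine Finset.sum_congr rfl (fun e _ => ?_)
  have h1 : (fun i => v (Equiv.Perm.decomposeFin.symm (p, e) i)) =
      (Fin.cons (v p) (fun i => v (Equiv.swap 0 p (e i).succ)) : Fin (n+1) → Ix) := by
    funext i
    refine Fin.cases ?_ (fun i => ?_) i <;> simp
  rw [h1]
  by_cases hp : p = 0 <;> simp [sgn, hp]

theorem asym_zero (f : (Fin 0 → Ix) → ℂ) (v : Fin 0 → Ix) : asym f v = f v := by
  unfold asym
  simp [sgn]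

def om3 (g : Fin 3 → Fin 3 → Pt → ℂ) (z : Pt) (v : Fin 6 → Ix) : ℂ :=
  omF g (v 0) (v 1) z * omF g (v 2) (v 3) z * omF g (v 4) (v 5) z

theorem volOm_eq (g : Fin 3 → Fin 3 → Pt → ℂ) (z : Pt) (v : Fin 6 → Ix) :
    volOm g v z = 48⁻¹ * asym (om3 g z) v := by
  unfold volOm wedge222 asym om3
  rw [← mul_assoc]
  congr 1
  · norm_num
  · refine Finset.sum_congr rfl (fun σ _ => by ring)

theorem volOm_zero (g : Fin 3 → Fin 3 → Pt → ℂ) (z : Pt) (v : Fin 6 → Ix)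
    (h : ∑ i, nHol (v i) ≠ 3) : volOm g v z = 0 := by
  rw [volOm_eq]
  unfold asym
  rw [Finset.sum_eq_zero, mul_zero]
  intro σ _
  rw [← Equiv.sum_comp σ (fun i => nHol (v i))] at h
  rw [Fin.sum_univ_six] at h
  unfold om3
  have key : ∀ a b, omF g a b z = 0 ∨ nHol a + nHol b = 1 := by
    rintro (a | a) (b | b) <;> simp [omF, nHol]
  rcases key (v (σ 0)) (v (σ 1)) with h1 | h1
  · simp [h1]
  rcases key (v (σ 2)) (v (σ 3)) with h2 | h2
  · simp [h2]
  rcases key (v (σ 4)) (v (σ 5)) with h3 | h3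
  · simp [h3]
  omega


theorem asym_succ' {n : ℕ} (f : (Fin (n+1) → Ix) → ℂ) (v : Fin (n+1) → Ix)
    (r : Fin (n+1) → Fin n → Ix) (h : ∀ p i, v (Equiv.swap 0 p i.succ) = r p i) :
    asym f v = asym (fun w => f (Matrix.vecCons (v 0) w)) (r 0)
      - ∑ p : Fin n, asym (fun w => f (Matrix.vecCons (v p.succ) w)) (r p.succ) := by
  rw [asym_succ, Fin.sum_univ_succ]
  simp only [h, Fin.succ_ne_zero, if_true, if_false, one_mul, neg_one_mul,
    Finset.sum_neg_distrib, sub_eq_add_neg]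
  rfl

theorem asym_smul {n : ℕ} (f : (Fin n → Ix) → ℂ) (v : Fin n → Ix) (c : ℂ) :
    asym (fun w => c * f w) v = c * asym f v := by
  unfold asym
  rw [Finset.mul_sum]
  exact Finset.sum_congr rfl (fun σ _ => by ring)

theorem asym_one (f : (Fin 1 → Ix) → ℂ) (a : Ix) : asym f ![a] = f ![a] := by
  rw [asym_succ' f ![a] ![![]] (by decide +revert)]
  simp [asym_zero]

theorem asym_two (f : (Fin 2 → Ix) → ℂ) (a b : Ix) :
    asym f ![a, b] = f ![a, b] - f ![b, a] := by
  rw [asym_succ' f ![a, b] ![![b], ![a]] (by intro p i; fin_cases p <;> fin_cases i <;> rfl)]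
  simp [asym_one]

theorem asym_three (f : (Fin 3 → Ix) → ℂ) (a b c : Ix) :
    asym f ![a, b, c] = asym (fun w => f (Matrix.vecCons a w)) ![b, c]
     - (asym (fun w => f (Matrix.vecCons b w)) ![a, c]
     + asym (fun w => f (Matrix.vecCons c w)) ![b, a]) := by
  rw [asym_succ' f ![a, b, c] ![![b, c], ![a, c], ![b, a]]
    (by intro p i; fin_cases p <;> fin_cases i <;> rfl)]
  simp [Fin.sum_univ_two]

theorem asym_four (f : (Fin 4 → Ix) → ℂ) (a b c d : Ix) :
    asym f ![a, b, c, d] = asym (fun w => f (Matrix.vecCons a w)) ![b, c, d]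
     - (asym (fun w => f (Matrix.vecCons b w)) ![a, c, d]
     + asym (fun w => f (Matrix.vecCons c w)) ![b, a, d]
     + asym (fun w => f (Matrix.vecCons d w)) ![b, c, a]) := by
  rw [asym_succ' f ![a, b, c, d] ![![b, c, d], ![a, c, d], ![b, a, d], ![b, c, a]]
    (by intro p i; fin_cases p <;> fin_cases i <;> rfl)]
  rw [Fin.sum_univ_three]
  rfl

theorem asym_five (f : (Fin 5 → Ix) → ℂ) (a b c d e : Ix) :
    asym f ![a, b, c, d, e] = asym (fun w => f (Matrix.vecCons a w)) ![b, c, d, e]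
     - (asym (fun w => f (Matrix.vecCons b w)) ![a, c, d, e]
     + asym (fun w => f (Matrix.vecCons c w)) ![b, a, d, e]
     + asym (fun w => f (Matrix.vecCons d w)) ![b, c, a, e]
     + asym (fun w => f (Matrix.vecCons e w)) ![b, c, d, a]) := by
  rw [asym_succ' f ![a, b, c, d, e]
    ![![b, c, d, e], ![a, c, d, e], ![b, a, d, e], ![b, c, a, e], ![b, c, d, a]]
    (by intro p i; fin_cases p <;> fin_cases i <;> rfl)]
  rw [Fin.sum_univ_four]
  rfl

theorem asym_six (f : (Fin 6 → Ix) → ℂ) (a b c d e k : Ix) :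
    asym f ![a, b, c, d, e, k] = asym (fun w => f (Matrix.vecCons a w)) ![b, c, d, e, k]
     - (asym (fun w => f (Matrix.vecCons b w)) ![a, c, d, e, k]
     + asym (fun w => f (Matrix.vecCons c w)) ![b, a, d, e, k]
     + asym (fun w => f (Matrix.vecCons d w)) ![b, c, a, e, k]
     + asym (fun w => f (Matrix.vecCons e w)) ![b, c, d, a, k]
     + asym (fun w => f (Matrix.vecCons k w)) ![b, c, d, e, a]) := by
  rw [asym_succ' f ![a, b, c, d, e, k]
    ![![b, c, d, e, k], ![a, c, d, e, k], ![b, a, d, e, k], ![b, c, a, e, k], ![b, c, d, a, k],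
      ![b, c, d, e, a]]
    (by intro p i; fin_cases p <;> fin_cases i <;> rfl)]
  rw [Fin.sum_univ_five]
  rfl

theorem pf_four (A : Ix → Ix → ℂ) (hA : ∀ x y, A x y = - A y x) (a b c d : Ix) :
    asym (fun v : Fin 4 → Ix => A (v 0) (v 1) * A (v 2) (v 3)) ![a, b, c, d] =
      8 * (A a b * A c d - A a c * A b d + A a d * A b c) := by
  simp only [asym_four, asym_three, asym_two, Matrix.cons_val]
  rw [hA b a, hA c a, hA d a, hA c b, hA d b, hA d c]
  ring

theorem om3_cons (A : Ix → Ix → ℂ) (x y : Ix) (u : Fin 4 → Ix) :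
    (fun v : Fin 6 → Ix => A (v 0) (v 1) * A (v 2) (v 3) * A (v 4) (v 5))
      (Matrix.vecCons x (Matrix.vecCons y u)) = A x y * (A (u 0) (u 1) * A (u 2) (u 3)) := by
  rw [← mul_assoc]
  rfl

theorem pf_six (A : Ix → Ix → ℂ) (hA : ∀ x y, A x y = - A y x) (a b c d e f : Ix) :
    asym (fun v : Fin 6 → Ix => A (v 0) (v 1) * A (v 2) (v 3) * A (v 4) (v 5))
      ![a, b, c, d, e, f] =
      48 * (A a b * (A c d * A e f - A c e * A d f + A c f * A d e)
          - A a c * (A b d * A e f - A b e * A d f + A b f * A d e)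
          + A a d * (A b c * A e f - A b e * A c f + A b f * A c e)
          - A a e * (A b c * A d f - A b d * A c f + A b f * A c d)
          + A a f * (A b c * A d e - A b d * A c e + A b e * A c d)) := by
  generalize hF : (fun v : Fin 6 → Ix => A (v 0) (v 1) * A (v 2) (v 3) * A (v 4) (v 5)) = F
  have hc : ∀ x y u, F (Matrix.vecCons x (Matrix.vecCons y u))
      = A x y * (A (u 0) (u 1) * A (u 2) (u 3)) := by
    intro x y u; rw [← hF]; exact om3_cons A x y u
  simp only [asym_six, asym_five, hc, asym_smul, pf_four A hA]
  rw [hA b a, hA c a, hA d a, hA e a, hA f a, hA c b, hA d b, hA e b, hA f b, hA d c, hA e c,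
    hA f c, hA e d, hA f d, hA f e]
  ring

theorem omF_anti (g : Fin 3 → Fin 3 → Pt → ℂ) (z : Pt) (x y : Ix) :
    omF g x y z = - omF g y x z := by
  rcases x with x | x <;> rcases y with y | y <;> simp [omF]

theorem volOm_std (g : Fin 3 → Fin 3 → Pt → ℂ) (z : Pt) (a b c d e f : Fin 3) :
    volOm g ![.inl a, .inl b, .inl c, .inr d, .inr e, .inr f] z = Complex.I *
     (g a d z * g b e z * g c f z - g a d z * g b f z * g c e z
      - g a e z * g b d z * g c f z + g a e z * g b f z * g c d z
      + g a f z * g b d z * g c e z - g a f z * g b e z * g c d z) := by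
  have hI : Complex.I ^ 3 = - Complex.I := by
    rw [pow_succ, Complex.I_sq]; ring
  rw [volOm_eq]
  have := pf_six (fun x y => omF g x y z) (omF_anti g z) (.inl a) (.inl b) (.inl c) (.inr d)
    (.inr e) (.inr f)
  unfold om3
  rw [this]
  simp only [omF, Pi.zero_apply]
  ring_nf
  rw [hI]
  ring

/-- The volume form is antisymmetric under exchange of two slots. -/
theorem volOm_swap (g : Fin 3 → Fin 3 → Pt → ℂ) (z : Pt) (v w : Fin 6 → Ix) (i j : Fin 6)
    (hij : i ≠ j) (h : ∀ k, w k = v (Equiv.swap i j k)) : volOm g w z = - volOm g v z := by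
  rw [volOm_eq, volOm_eq, asym_swap _ v w i j hij h]
  ring

theorem vol_swap01 (g : Fin 3 → Fin 3 → Pt → ℂ) (z : Pt) (a b c d e f : Ix) :
    volOm g ![a, b, c, d, e, f] z = - volOm g ![b, a, c, d, e, f] z :=
  volOm_swap g z _ _ 0 1 (by decide) (by intro k; fin_cases k <;> rfl)

theorem vol_swap12 (g : Fin 3 → Fin 3 → Pt → ℂ) (z : Pt) (a b c d e f : Ix) :
    volOm g ![a, b, c, d, e, f] z = - volOm g ![a, c, b, d, e, f] z :=
  volOm_swap g z _ _ 1 2 (by decide) (by intro k; fin_cases k <;> rfl)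

theorem vol_swap34 (g : Fin 3 → Fin 3 → Pt → ℂ) (z : Pt) (a b c d e f : Ix) :
    volOm g ![a, b, c, d, e, f] z = - volOm g ![a, b, c, e, d, f] z :=
  volOm_swap g z _ _ 3 4 (by decide) (by intro k; fin_cases k <;> rfl)

theorem vol_swap45 (g : Fin 3 → Fin 3 → Pt → ℂ) (z : Pt) (a b c d e f : Ix) :
    volOm g ![a, b, c, d, e, f] z = - volOm g ![a, b, c, d, f, e] z :=
  volOm_swap g z _ _ 4 5 (by decide) (by intro k; fin_cases k <;> rfl)

theorem vol_swap03 (g : Fin 3 → Fin 3 → Pt → ℂ) (z : Pt) (a b c d e f : Ix) :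
    volOm g ![a, b, c, d, e, f] z = - volOm g ![d, b, c, a, e, f] z :=
  volOm_swap g z _ _ 0 3 (by decide) (by intro k; fin_cases k <;> rfl)

theorem vol_swap14 (g : Fin 3 → Fin 3 → Pt → ℂ) (z : Pt) (a b c d e f : Ix) :
    volOm g ![a, b, c, d, e, f] z = - volOm g ![a, e, c, d, b, f] z :=
  volOm_swap g z _ _ 1 4 (by decide) (by intro k; fin_cases k <;> rfl)

theorem vol_swap25 (g : Fin 3 → Fin 3 → Pt → ℂ) (z : Pt) (a b c d e f : Ix) :
    volOm g ![a, b, c, d, e, f] z = - volOm g ![a, b, f, d, e, c] z :=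
  volOm_swap g z _ _ 2 5 (by decide) (by intro k; fin_cases k <;> rfl)

section sums
variable {ι : Type} [Fintype ι]

theorem sum_swap12 (A : ι → ι → ι → ℂ) :
    ∑ q, ∑ r, ∑ s, A q r s = ∑ q, ∑ r, ∑ s, A r q s := Finset.sum_comm

theorem sum_swap23 (A : ι → ι → ι → ℂ) :
    ∑ q, ∑ r, ∑ s, A q r s = ∑ q, ∑ r, ∑ s, A q s r :=
  Finset.sum_congr rfl (fun _ _ => Finset.sum_comm)

theorem sum_sym23 (A B : ι → ι → ι → ℂ)
    (h : ∀ q r s, A q r s + A q s r = B q r s + B q s r) :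
    ∑ q, ∑ r, ∑ s, A q r s = ∑ q, ∑ r, ∑ s, B q r s := by
  have h1 : ∑ q, ∑ r, ∑ s, (A q r s + A q s r) = ∑ q, ∑ r, ∑ s, (B q r s + B q s r) := by
    simp only [h]
  simp only [Finset.sum_add_distrib] at h1
  linear_combination (1/2 : ℂ) * h1 + (1/2 : ℂ) * sum_swap23 A - (1/2 : ℂ) * sum_swap23 B

theorem sum_sym12 (A B : ι → ι → ι → ℂ)
    (h : ∀ q r s, A q r s + A r q s = B q r s + B r q s) :
    ∑ q, ∑ r, ∑ s, A q r s = ∑ q, ∑ r, ∑ s, B q r s := by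
  have h1 : ∑ q, ∑ r, ∑ s, (A q r s + A r q s) = ∑ q, ∑ r, ∑ s, (B q r s + B r q s) := by
    simp only [h]
  simp only [Finset.sum_add_distrib] at h1
  linear_combination (1/2 : ℂ) * h1 + (1/2 : ℂ) * sum_swap12 A - (1/2 : ℂ) * sum_swap12 B

theorem sum_sym123 (A B : ι → ι → ι → ℂ)
    (h : ∀ q r s, A q r s + A r q s + A q s r + A s q r + A r s q + A s r q
      = B q r s + B r q s + B q s r + B s q r + B r s q + B s r q) :
    ∑ q, ∑ r, ∑ s, A q r s = ∑ q, ∑ r, ∑ s, B q r s := by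
  have key : ∀ A : ι → ι → ι → ℂ, ∑ q, ∑ r, ∑ s, A q r s = (1/6 : ℂ) *
      ∑ q, ∑ r, ∑ s, (A q r s + A r q s + A q s r + A s q r + A r s q + A s r q) := by
    intro A
    simp only [Finset.sum_add_distrib]
    have h1 := sum_swap12 A
    have h2 := sum_swap23 A
    have h3 := sum_swap23 (fun q r s => A r q s)
    have h4 := sum_swap12 (fun q r s => A q s r)
    have h5 := sum_swap12 (fun q r s => A s q r)
    linear_combination (1/6 : ℂ) * (h1 + h2 + (h1 + h3) + (h2 + h4) + (h1 + h3 + h5))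
  rw [key A, key B]
  simp only [h]
end sums

/-- Sum over triples of complexified indices of a symmetric function, by type. -/
theorem sum_types (Y : Ix → Ix → Ix → ℂ) (h1 : ∀ a b c, Y a b c = Y b a c)
    (h2 : ∀ a b c, Y a b c = Y a c b) :
    ∑ q, ∑ r, ∑ s, Y q r s =
      (∑ q : Fin 3, ∑ r : Fin 3, ∑ s : Fin 3, Y (.inl q) (.inl r) (.inl s))
      + 3 * (∑ q : Fin 3, ∑ r : Fin 3, ∑ s : Fin 3, Y (.inl q) (.inl r) (.inr s))
      + 3 * (∑ q : Fin 3, ∑ r : Fin 3, ∑ s : Fin 3, Y (.inl q) (.inr r) (.inr s))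
      + (∑ q : Fin 3, ∑ r : Fin 3, ∑ s : Fin 3, Y (.inr q) (.inr r) (.inr s)) := by
  simp only [Fintype.sum_sum_type, Finset.sum_add_distrib]
  have e1 : ∑ q : Fin 3, ∑ r : Fin 3, ∑ s : Fin 3, Y (.inl q) (.inr r) (.inl s)
      = ∑ q : Fin 3, ∑ r : Fin 3, ∑ s : Fin 3, Y (.inl q) (.inl r) (.inr s) := by
    rw [sum_swap23]
    simp only [h2 (.inl _) (.inr _) (.inl _)]
  have e2 : ∑ q : Fin 3, ∑ r : Fin 3, ∑ s : Fin 3, Y (.inr q) (.inl r) (.inl s)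
      = ∑ q : Fin 3, ∑ r : Fin 3, ∑ s : Fin 3, Y (.inl q) (.inl r) (.inr s) := by
    rw [← e1, sum_swap12]
    simp only [h1 (.inr _) (.inl _) (.inl _)]
  have e3 : ∑ q : Fin 3, ∑ r : Fin 3, ∑ s : Fin 3, Y (.inr q) (.inl r) (.inr s)
      = ∑ q : Fin 3, ∑ r : Fin 3, ∑ s : Fin 3, Y (.inl q) (.inr r) (.inr s) := by
    rw [sum_swap12]
    simp only [h1 (.inr _) (.inl _) (.inr _)]
  have e4 : ∑ q : Fin 3, ∑ r : Fin 3, ∑ s : Fin 3, Y (.inr q) (.inr r) (.inl s)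
      = ∑ q : Fin 3, ∑ r : Fin 3, ∑ s : Fin 3, Y (.inl q) (.inr r) (.inr s) := by
    rw [← e3, sum_swap23]
    simp only [h2 (.inr _) (.inr _) (.inl _)]
  rw [e1, e2, e3, e4]
  ring

/-- The form with all indices raised. -/
def rX (ginv : Fin 3 → Fin 3 → Pt → ℂ) (χ : Ix → Ix → Ix → Pt → ℂ) (z : Pt) (q r s : Ix) : ℂ :=
  ∑ s', ginvF ginv s s' z * ∑ r', ginvF ginv r r' z * ∑ q', ginvF ginv q q' z * χ q' r' s' z

theorem rX_flat (ginv : Fin 3 → Fin 3 → Pt → ℂ) (χ : Ix → Ix → Ix → Pt → ℂ) (z : Pt)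
    (q r s : Ix) : rX ginv χ z q r s = ∑ q', ∑ r', ∑ s',
      ginvF ginv q q' z * ginvF ginv r r' z * ginvF ginv s s' z * χ q' r' s' z := by
  unfold rX
  simp only [Finset.mul_sum]
  rw [sum_swap23, sum_swap12, sum_swap23]
  refine Finset.sum_congr rfl fun _ _ => Finset.sum_congr rfl fun _ _ =>
    Finset.sum_congr rfl fun _ _ => by ring

theorem rX_swap12 (ginv : Fin 3 → Fin 3 → Pt → ℂ) (χ : Ix → Ix → Ix → Pt → ℂ) (z : Pt)
    (hχ1 : ∀ a b c z, χ a b c z = -χ b a c z) (q r s : Ix) :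
    rX ginv χ z q r s = - rX ginv χ z r q s := by
  rw [rX_flat, rX_flat, sum_swap12]
  simp only [← Finset.sum_neg_distrib]
  refine Finset.sum_congr rfl fun a _ => Finset.sum_congr rfl fun b _ =>
    Finset.sum_congr rfl fun c _ => ?_
  rw [hχ1]; ring

theorem rX_swap23 (ginv : Fin 3 → Fin 3 → Pt → ℂ) (χ : Ix → Ix → Ix → Pt → ℂ) (z : Pt)
    (hχ2 : ∀ a b c z, χ a b c z = -χ a c b z) (q r s : Ix) :
    rX ginv χ z q r s = - rX ginv χ z q s r := by
  rw [rX_flat, rX_flat, sum_swap23]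
  simp only [← Finset.sum_neg_distrib]
  refine Finset.sum_congr rfl fun a _ => Finset.sum_congr rfl fun b _ =>
    Finset.sum_congr rfl fun c _ => ?_
  rw [hχ2]; ring

theorem hstar_eq (g ginv : Fin 3 → Fin 3 → Pt → ℂ) (χ : Ix → Ix → Ix → Pt → ℂ) (z : Pt)
    (hχ1 : ∀ a b c z, χ a b c z = -χ b a c z)
    (hχ2 : ∀ a b c z, χ a b c z = -χ a c b z) (m n p : Ix) :
    hstar g ginv χ m n p z = 6⁻¹ * (
      (∑ q : Fin 3, ∑ r : Fin 3, ∑ s : Fin 3,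
        rX ginv χ z (.inl q) (.inl r) (.inl s) * volOm g ![.inl q, .inl r, .inl s, m, n, p] z)
      + 3 * (∑ q : Fin 3, ∑ r : Fin 3, ∑ s : Fin 3,
        rX ginv χ z (.inl q) (.inl r) (.inr s) * volOm g ![.inl q, .inl r, .inr s, m, n, p] z)
      + 3 * (∑ q : Fin 3, ∑ r : Fin 3, ∑ s : Fin 3,
        rX ginv χ z (.inl q) (.inr r) (.inr s) * volOm g ![.inl q, .inr r, .inr s, m, n, p] z)
      + (∑ q : Fin 3, ∑ r : Fin 3, ∑ s : Fin 3,
        rX ginv χ z (.inr q) (.inr r) (.inr s) * volOm g ![.inr q, .inr r, .inr s, m, n, p] z)) := by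
  rw [← sum_types (fun q r s => rX ginv χ z q r s * volOm g ![q, r, s, m, n, p] z)]
  · unfold hstar
    simp only [rX_flat, Finset.sum_mul]
  · intro a b c
    rw [rX_swap12 ginv χ z hχ1, vol_swap01]; ring
  · intro a b c
    rw [rX_swap23 ginv χ z hχ2, vol_swap12]; ring

section contr
variable (g ginv : Fin 3 → Fin 3 → Pt → ℂ) (χ : Ix → Ix → Ix → Pt → ℂ) (z : Pt)

theorem contr (hinv1 : ∀ z α β, ∑ σ, ginv α σ z * g β σ z = (if α = β then (1:ℂ) else 0))
    (hinv2 : ∀ z σ τ, ∑ α, ginv α σ z * g α τ z = (if σ = τ then (1:ℂ) else 0))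
    (a : Ix) (f : Ix → ℂ) :
    ∑ q, gF g a q z * ∑ q', ginvF ginv q q' z * f q' = f a := by
  simp only [Finset.mul_sum]
  rw [Finset.sum_comm]
  have h : ∀ q', ∑ q, gF g a q z * (ginvF ginv q q' z * f q') = (if q' = a then 1 else 0) * f q' := by
    intro q'
    simp only [← mul_assoc]
    rw [← Finset.sum_mul]
    congr 1
    rcases a with a | a <;> rcases q' with b | b <;>
      simp [Fintype.sum_sum_type, gF, ginvF, mul_comm (g _ _ z), hinv1, hinv2]
  simp [h]

theorem lower_s12 (hinv1 : ∀ z α β, ∑ σ, ginv α σ z * g β σ z = (if α = β then (1:ℂ) else 0))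
    (hinv2 : ∀ z σ τ, ∑ α, ginv α σ z * g α τ z = (if σ = τ then (1:ℂ) else 0))
    (a b c : Ix) :
    χ a b c z = ∑ q, ∑ r, ∑ s, gF g a q z * (gF g b r z * (gF g c s z * rX ginv χ z q r s)) := by
  simp only [← Finset.mul_sum]
  unfold rX
  simp only [contr g ginv z hinv1 hinv2]

theorem lam_eq (hinv1 : ∀ z α β, ∑ σ, ginv α σ z * g β σ z = (if α = β then (1:ℂ) else 0))
    (hinv2 : ∀ z σ τ, ∑ α, ginv α σ z * g α τ z = (if σ = τ then (1:ℂ) else 0)) (k : Ix) :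
    iLam3 ginv χ k z = ∑ q : Fin 3, ∑ r : Fin 3, ∑ s : Ix,
      g q r z * (gF g k s z * rX ginv χ z (.inr r) (.inl q) s) := by
  simp only [← Finset.mul_sum]
  unfold rX
  simp only [contr g ginv z hinv1 hinv2]
  simp only [Fintype.sum_sum_type, ginvF, Pi.zero_apply, zero_mul, Finset.sum_const_zero, zero_add,
    add_zero]
  unfold iLam3
  rw [Finset.sum_comm]
  conv_rhs => rw [Finset.sum_comm]
  refine Finset.sum_congr rfl fun ν _ => ?_
  have h : ∀ f : Fin 3 → ℂ, ∑ q, g q ν z * ∑ x, ginv q x z * f x = f ν := by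
    intro f
    simp only [Finset.mul_sum]
    rw [Finset.sum_comm]
    have h : ∀ q', ∑ q, g q ν z * (ginv q q' z * f q') = (if q' = ν then 1 else 0) * f q' := by
      intro q'
      rw [← hinv2 z, Finset.sum_mul]
      exact Finset.sum_congr rfl fun _ _ => by ring
    simp [h]
  rw [h]
end contr

theorem I_pow3 : Complex.I ^ 3 = - Complex.I := by
  rw [pow_succ, Complex.I_sq]; ring

section cases
variable (g ginv : Fin 3 → Fin 3 → Pt → ℂ) (χ : Ix → Ix → Ix → Pt → ℂ) (z : Pt)

/-- Difference of the two sides. -/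
def Dif (m n p : Ix) : ℂ :=
  hstar g ginv χ m n p z - (jfac m * jfac n * jfac p * χ m n p z
          - wedge12 (fun k w => jfac k * Lam3 ginv χ k w) (omF g) m n p z)

variable (hinv1 : ∀ z α β, ∑ σ, ginv α σ z * g β σ z = (if α = β then (1:ℂ) else 0))
    (hinv2 : ∀ z σ τ, ∑ α, ginv α σ z * g α τ z = (if σ = τ then (1:ℂ) else 0))
    (hχ1 : ∀ a b c z, χ a b c z = -χ b a c z)
    (hχ2 : ∀ a b c z, χ a b c z = -χ a c b z)

theorem Dif_swap12 (hχ1 : ∀ a b c z, χ a b c z = -χ b a c z) (m n p : Ix) :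
    Dif g ginv χ z m n p = - Dif g ginv χ z n m p := by
  have h : hstar g ginv χ m n p z = - hstar g ginv χ n m p z := by
    unfold hstar
    simp only [vol_swap34 g z _ _ _ m n p, mul_neg, Finset.sum_neg_distrib]
  unfold Dif wedge12
  rw [h, hχ1 m n p, omF_anti g z m n]
  ring

theorem Dif_swap23 (hχ2 : ∀ a b c z, χ a b c z = -χ a c b z) (m n p : Ix) :
    Dif g ginv χ z m n p = - Dif g ginv χ z m p n := by
  have h : hstar g ginv χ m n p z = - hstar g ginv χ m p n z := by
    unfold hstar
    simp only [vol_swap45 g z _ _ _ m n p, mul_neg, Finset.sum_neg_distrib]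
  unfold Dif wedge12
  rw [h, hχ2 m n p, omF_anti g z n p]
  ring

include hinv1 hinv2 hχ1 hχ2

theorem Dif_hhh (m n p : Fin 3) : Dif g ginv χ z (.inl m) (.inl n) (.inl p) = 0 := by
  unfold Dif
  rw [hstar_eq g ginv χ z hχ1 hχ2, sub_eq_zero]
  have v1 : ∀ q r s : Fin 3, volOm g ![.inl q, .inl r, .inl s, .inl m, .inl n, .inl p] z = 0 :=
    fun q r s => volOm_zero g z _ (by simp [Fin.sum_univ_six, nHol])
  have v2 : ∀ q r s : Fin 3, volOm g ![.inl q, .inl r, .inr s, .inl m, .inl n, .inl p] z = 0 :=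
    fun q r s => volOm_zero g z _ (by simp [Fin.sum_univ_six, nHol])
  have v3 : ∀ q r s : Fin 3, volOm g ![.inl q, .inr r, .inr s, .inl m, .inl n, .inl p] z = 0 :=
    fun q r s => volOm_zero g z _ (by simp [Fin.sum_univ_six, nHol])
  rw [lower_s12 g ginv χ z hinv1 hinv2]
  simp only [v1, v2, v3, vol_swap03 g z (.inr _), vol_swap14 g z _ (.inr _) _ _ (.inl _),
    vol_swap25 g z _ _ (.inr _), volOm_std, wedge12, omF, gF, jfac, Fintype.sum_sum_type,
    Pi.zero_apply, zero_mul, mul_zero, Finset.sum_const_zero, zero_add, add_zero, sub_zero]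
  simp only [Finset.mul_sum]
  apply sum_sym123
  intro q r s
  have x1 := rX_swap12 ginv χ z hχ1 (.inr r) (.inr q) (.inr s)
  have x2 := rX_swap23 ginv χ z hχ2 (.inr q) (.inr s) (.inr r)
  have x3 := rX_swap12 ginv χ z hχ1 (.inr s) (.inr q) (.inr r)
  have x4 := rX_swap23 ginv χ z hχ2 (.inr r) (.inr s) (.inr q)
  have x5 := rX_swap12 ginv χ z hχ1 (.inr s) (.inr r) (.inr q)
  rw [x5, x4, x3, x2, x1]
  ring_nf
  rw [I_pow3]
  ring

theorem Dif_aaa (m n p : Fin 3) : Dif g ginv χ z (.inr m) (.inr n) (.inr p) = 0 := by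
  unfold Dif
  rw [hstar_eq g ginv χ z hχ1 hχ2, sub_eq_zero]
  have v1 : ∀ q r s : Fin 3, volOm g ![.inr q, .inr r, .inr s, .inr m, .inr n, .inr p] z = 0 :=
    fun q r s => volOm_zero g z _ (by simp [Fin.sum_univ_six, nHol])
  have v2 : ∀ q r s : Fin 3, volOm g ![.inl q, .inl r, .inr s, .inr m, .inr n, .inr p] z = 0 :=
    fun q r s => volOm_zero g z _ (by simp [Fin.sum_univ_six, nHol])
  have v3 : ∀ q r s : Fin 3, volOm g ![.inl q, .inr r, .inr s, .inr m, .inr n, .inr p] z = 0 :=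
    fun q r s => volOm_zero g z _ (by simp [Fin.sum_univ_six, nHol])
  rw [lower_s12 g ginv χ z hinv1 hinv2]
  simp only [v1, v2, v3, volOm_std, wedge12, omF, gF, jfac, Fintype.sum_sum_type,
    Pi.zero_apply, zero_mul, mul_zero, Finset.sum_const_zero, zero_add, add_zero, sub_zero]
  simp only [Finset.mul_sum]
  apply sum_sym123
  intro q r s
  have x1 := rX_swap12 ginv χ z hχ1 (.inl r) (.inl q) (.inl s)
  have x2 := rX_swap23 ginv χ z hχ2 (.inl q) (.inl s) (.inl r)
  have x3 := rX_swap12 ginv χ z hχ1 (.inl s) (.inl q) (.inl r)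
  have x4 := rX_swap23 ginv χ z hχ2 (.inl r) (.inl s) (.inl q)
  have x5 := rX_swap12 ginv χ z hχ1 (.inl s) (.inl r) (.inl q)
  rw [x5, x4, x3, x2, x1]
  ring_nf
  rw [I_pow3]
  ring

theorem Dif_hha (m n p : Fin 3) : Dif g ginv χ z (.inl m) (.inl n) (.inr p) = 0 := by
  unfold Dif
  rw [hstar_eq g ginv χ z hχ1 hχ2, sub_eq_zero]
  have v1 : ∀ q r s : Fin 3, volOm g ![.inl q, .inl r, .inl s, .inl m, .inl n, .inr p] z = 0 :=
    fun q r s => volOm_zero g z _ (by simp [Fin.sum_univ_six, nHol])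
  have v2 : ∀ q r s : Fin 3, volOm g ![.inl q, .inl r, .inr s, .inl m, .inl n, .inr p] z = 0 :=
    fun q r s => volOm_zero g z _ (by simp [Fin.sum_univ_six, nHol])
  have v3 : ∀ q r s : Fin 3, volOm g ![.inr q, .inr r, .inr s, .inl m, .inl n, .inr p] z = 0 :=
    fun q r s => volOm_zero g z _ (by simp [Fin.sum_univ_six, nHol])
  have v4 : ∀ q r s : Fin 3, volOm g ![.inl q, .inr r, .inr s, .inl m, .inl n, .inr p] z =
      volOm g ![.inl q, .inl n, .inl m, .inr s, .inr r, .inr p] z := by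
    intro q r s
    rw [vol_swap14]
    rw [volOm_swap g z ![.inl q, .inl n, .inl m, .inr s, .inr r, .inr p] _ 2 3 (by decide)
      (by intro k; fin_cases k <;> rfl)]
    ring
  have lamE : ∀ k : Fin 3, iLam3 ginv χ (.inl k) z = ∑ q : Fin 3, ∑ r : Fin 3, ∑ s : Fin 3,
      -(g q r z * (g k s z * rX ginv χ z (.inl q) (.inr r) (.inr s))) := by
    intro k
    rw [lam_eq g ginv χ z hinv1 hinv2]
    simp only [gF, Fintype.sum_sum_type, Pi.zero_apply, zero_mul, mul_zero,
      Finset.sum_const_zero, zero_add, rX_swap12 ginv χ z hχ1 (.inr _) (.inl _), mul_neg, neg_zero]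
  have chiE : χ (.inl m) (.inl n) (.inr p) z = ∑ q : Fin 3, ∑ r : Fin 3, ∑ s : Fin 3,
      (g m r z * (g n s z * (g q p z * rX ginv χ z (.inl q) (.inr r) (.inr s)))) := by
    rw [lower_s12 g ginv χ z hinv1 hinv2]
    simp only [gF, Fintype.sum_sum_type, Pi.zero_apply, zero_mul, mul_zero,
      Finset.sum_const_zero, zero_add, add_zero]
    rw [sum_swap23, sum_swap12]
    refine Finset.sum_congr rfl fun q _ => Finset.sum_congr rfl fun r _ =>
      Finset.sum_congr rfl fun s _ => ?_
    rw [rX_swap23 ginv χ z hχ2 (.inr r), rX_swap12 ginv χ z hχ1 (.inr r)]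
    ring
  simp only [v1, v2, v3, v4, volOm_std, wedge12, omF, Lam3, lamE, chiE, jfac,
    Pi.zero_apply, zero_mul, mul_zero, Finset.sum_const_zero, zero_add, add_zero, sub_zero]
  simp only [Finset.mul_sum, Finset.sum_mul, ← Finset.sum_sub_distrib]
  apply sum_sym23
  intro q r s
  rw [rX_swap23 ginv χ z hχ2 (.inl q) (.inr s) (.inr r)]
  ring_nf
  rw [I_pow3]
  ring

theorem Dif_haa (m n p : Fin 3) : Dif g ginv χ z (.inl m) (.inr n) (.inr p) = 0 := by
  unfold Dif
  rw [hstar_eq g ginv χ z hχ1 hχ2, sub_eq_zero]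
  have v1 : ∀ q r s : Fin 3, volOm g ![.inl q, .inl r, .inl s, .inl m, .inr n, .inr p] z = 0 :=
    fun q r s => volOm_zero g z _ (by simp [Fin.sum_univ_six, nHol])
  have v2 : ∀ q r s : Fin 3, volOm g ![.inl q, .inr r, .inr s, .inl m, .inr n, .inr p] z = 0 :=
    fun q r s => volOm_zero g z _ (by simp [Fin.sum_univ_six, nHol])
  have v3 : ∀ q r s : Fin 3, volOm g ![.inr q, .inr r, .inr s, .inl m, .inr n, .inr p] z = 0 :=
    fun q r s => volOm_zero g z _ (by simp [Fin.sum_univ_six, nHol])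
  have v4 : ∀ q r s : Fin 3, volOm g ![.inl q, .inl r, .inr s, .inl m, .inr n, .inr p] z =
      - volOm g ![.inl q, .inl r, .inl m, .inr s, .inr n, .inr p] z := by
    intro q r s
    rw [volOm_swap g z ![.inl q, .inl r, .inl m, .inr s, .inr n, .inr p] _ 2 3 (by decide)
      (by intro k; fin_cases k <;> rfl)]
  have lamE : ∀ k : Fin 3, iLam3 ginv χ (.inr k) z = ∑ q : Fin 3, ∑ r : Fin 3, ∑ s : Fin 3,
      (g q s z * (g r k z * rX ginv χ z (.inl q) (.inl r) (.inr s))) := by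
    intro k
    rw [lam_eq g ginv χ z hinv1 hinv2]
    simp only [gF, Fintype.sum_sum_type, Pi.zero_apply, zero_mul, mul_zero,
      Finset.sum_const_zero, add_zero]
    rw [sum_swap23]
    refine Finset.sum_congr rfl fun q _ => Finset.sum_congr rfl fun r _ =>
      Finset.sum_congr rfl fun s _ => ?_
    rw [rX_swap12 ginv χ z hχ1 (.inr s), rX_swap23 ginv χ z hχ2 (.inl q) (.inr s)]
    ring
  have chiE : χ (.inl m) (.inr n) (.inr p) z = ∑ q : Fin 3, ∑ r : Fin 3, ∑ s : Fin 3,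
      (g m s z * (g q n z * (g r p z * rX ginv χ z (.inl q) (.inl r) (.inr s)))) := by
    rw [lower_s12 g ginv χ z hinv1 hinv2]
    simp only [gF, Fintype.sum_sum_type, Pi.zero_apply, zero_mul, mul_zero,
      Finset.sum_const_zero, zero_add, add_zero]
    rw [sum_swap12, sum_swap23]
    refine Finset.sum_congr rfl fun q _ => Finset.sum_congr rfl fun r _ =>
      Finset.sum_congr rfl fun s _ => ?_
    rw [rX_swap12 ginv χ z hχ1 (.inr s), rX_swap23 ginv χ z hχ2 (.inl q) (.inr s)]
    ring
  simp only [v1, v2, v3, v4, volOm_std, wedge12, omF, Lam3, lamE, chiE, jfac,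
    Pi.zero_apply, zero_mul, mul_zero, Finset.sum_const_zero, zero_add, add_zero, sub_zero,
    zero_sub]
  simp only [Finset.mul_sum, Finset.sum_mul, ← Finset.sum_sub_distrib, ← Finset.sum_neg_distrib,
    ← Finset.sum_add_distrib]
  apply sum_sym12
  intro q r s
  rw [rX_swap12 ginv χ z hχ1 (.inl r) (.inl q)]
  ring_nf
  rw [I_pow3]
  ring

theorem Dif_zero (m n p : Ix) : Dif g ginv χ z m n p = 0 := by
  have s12 := Dif_swap12 g ginv χ z hχ1
  have s23 := Dif_swap23 g ginv χ z hχ2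
  have a1 := Dif_hhh g ginv χ z hinv1 hinv2 hχ1 hχ2
  have a2 := Dif_hha g ginv χ z hinv1 hinv2 hχ1 hχ2
  have a3 := Dif_haa g ginv χ z hinv1 hinv2 hχ1 hχ2
  have a4 := Dif_aaa g ginv χ z hinv1 hinv2 hχ1 hχ2
  rcases m with m | m <;> rcases n with n | n <;> rcases p with p | p
  · exact a1 m n p
  · exact a2 m n p
  · rw [s23, a2, neg_zero]
  · exact a3 m n p
  · rw [s12, s23, a2, neg_zero, neg_zero]
  · rw [s12, a3, neg_zero]
  · rw [s23, s12, a3, neg_zero, neg_zero]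
  · exact a4 m n p
end cases

theorem stmt12 (g ginv : Fin 3 → Fin 3 → Pt → ℂ) (χ : Ix → Ix → Ix → Pt → ℂ)
    -- the metric components are smooth
    (hg : ∀ μ ν, ContDiff ℝ (⊤ : ℕ∞) (g μ ν)) (hginvsm : ∀ μ ν, ContDiff ℝ (⊤ : ℕ∞) (ginv μ ν))
    -- hermitian: `conj g_{μν̄} = g_{νμ̄}`, and positive
    (hherm : ∀ μ ν z, (starRingEnd ℂ) (g μ ν z) = g ν μ z)
    (hpos : ∀ z (v : Fin 3 → ℂ), v ≠ 0 →
      0 < (∑ μ, ∑ ν, g μ ν z * v μ * (starRingEnd ℂ) (v ν)).re)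
    -- `ginv` is the inverse metric: `g^{ασ̄} g_{βσ̄} = δ^α_β` and `g^{ασ̄} g_{ατ̄} = δ^σ̄_τ̄`
    (hinv1 : ∀ z α β, ∑ σ, ginv α σ z * g β σ z = (if α = β then (1:ℂ) else 0))
    (hinv2 : ∀ z σ τ, ∑ α, ginv α σ z * g α τ z = (if σ = τ then (1:ℂ) else 0))
    -- `χ` is a 3-form (totally antisymmetric)
    (hχ1 : ∀ a b c z, χ a b c z = -χ b a c z)
    (hχ2 : ∀ a b c z, χ a b c z = -χ a c b z) :
    -- conclusion: `⋆χ = Jχ − J(Λ_ω χ) ∧ ω`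
    ∀ (m n p : Ix) (z : Pt),
      hstar g ginv χ m n p z
        = jfac m * jfac n * jfac p * χ m n p z
          - wedge12 (fun k w => jfac k * Lam3 ginv χ k w) (omF g) m n p z := by

  intro m n p z
  exact sub_eq_zero.mp (Dif_zero g ginv χ z hinv1 hinv2 hχ1 hχ2 m n p)
end
end
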